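/- Write $\langle t\rangle_T = e + t/T$ for $T>0$, $t\ge 0$. Let $(\rho,u,\nabla\Pi)$ be a smooth global solution on $[0,\infty)\times\mathbb R^2$ of the inhomogeneous incompressible Navier–Stokes system $$\partial_t\rho+u\cdot\nabla\rho=0,\qquad \rho\,\partial_t u+\rho\,(u\cdot\nabla)u-\Delta u+\nabla\Pi=0,\qquad \operatorname{div}u=0,$$ with $\tfrac12\le\rho\le 2$, and let $v$ (a time-dependent vector field), $\Pi_v$ (a scalar function) and $f$ (a time-dependent vector field) satisfy the linearized system $$\rho\,\partial_t v+\rho\,(u\cdot\nabla)v-\Delta v+\nabla\Pi_v=f,\qquad \operatorname{div}v=0 .$$ Here $\rho$ is smooth on $[0,\infty)\times\mathbb R^2$, and $u,\nabla\Pi,v,\nabla\Pi_v,f$ are smooth in time on $[0,\infty)$ with values in every Sobolev space $H^k(\mathbb R^2)$. Set $$D(t)=\|\sqrt{\rho}\,\partial_t v(t)\|_{L^2}^2+\|\nabla^2v(t)\|_{L^2}^2+\|\nabla\Pi_v(t)\|_{L^2}^2 .$$ There are an absolute constant $C>0$ and, for every real $s>0$, a constant $C_s>0$ depending only on $s$,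 such that for all such $(\rho,u,\Pi,v,\Pi_v,f)$: (i) for all $0\le t_0\le t$, $$\|\nabla v(t)\|_{L^2}^2+\int_{t_0}^t D(t')\,dt'\le C\Big(\|\nabla v(t_0)\|_{L^2}^2+\int_{t_0}^t\|f(t')\|_{L^2}^2\,dt'\Big)\exp\big(C\|u(t_0)\|_{L^2}^4\big);$$ (ii) for all $s>0$, $T>0$ and $0\le t_0\le t$, $$\langle t\rangle_T^s\|\nabla v(t)\|_{L^2}^2+\int_{t_0}^t\langle t'\rangle_T^s D(t')\,dt'\le C_s\Big(\langle t_0\rangle_T^s\|\nabla v(t_0)\|_{L^2}^2+\int_{t_0}^t\langle t'\rangle_T^{s-1}\|\nabla v(t')\|_{L^2}^2\,\frac{dt'}{T}+\int_{t_0}^t\langle t'\rangle_T^s\|f(t')\|_{L^2}^2\,dt'\Big)\exp\big(C_s\|u(t_0)\|_{L^2}^4\big);$$ (iii) for all $t>0$, $$t\|\nabla v(t)\|_{L^2}^2\le C\Big(\|v(t/2)\|_{L^2}^2+t\int_{t/2}^t\|f(t')\|_{L^2}^2\,dt'\Big)\exp\big(C\|u(t/2)\|_{L^2}^4\big).$$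 -/

import Mathlib

noncomputable section

open MeasureTheory Set Filter Topology
open scoped ENNReal ContDiff Laplacian

/-- The plane `ℝ²`, with its Euclidean norm. -/
abbrev Plane : Type := EuclideanSpace ℝ (Fin 2)

/-- The `i`-th vector of the canonical basis of `ℝ²`. -/
def basisVec (i : Fin 2) : Plane := EuclideanSpace.single i 1

/-- The divergence of a vector field on `ℝ²`. -/
def divergence (w : Plane → Plane) (x : Plane) : ℝ :=
  ∑ i, fderiv ℝ w x (basisVec i) i

/-- The full gradient `∇w = (∂₁w, ∂₂w)`, with the Euclidean (Hilbert–Schmidt) norm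
`|∇w|² = |∂₁w|² + |∂₂w|²`. The Hessian `∇²w` is `grad (grad w)`. -/
def grad {F : Type*} [NormedAddCommGroup F] [NormedSpace ℝ F] (w : Plane → F) (x : Plane) :
    PiLp 2 (fun _ : Fin 2 => F) :=
  WithLp.toLp 2 (fun i => fderiv ℝ w x (basisVec i))

/-- The `j`-th time derivative of a field on `[0,∞) × ℝ²` (one-sided at `t = 0`). -/
def timeDerivN {F : Type*} [NormedAddCommGroup F] [NormedSpace ℝ F] (j : ℕ)
    (w : ℝ → Plane → F) (t : ℝ) (x : Plane) : F :=
  iteratedDerivWithin j (fun τ => w τ x) (Ici 0) t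

/-- The time derivative of a field on `[0,∞) × ℝ²` (one-sided at `t = 0`). -/
def timeDeriv {F : Type*} [NormedAddCommGroup F] [NormedSpace ℝ F]
    (w : ℝ → Plane → F) (t : ℝ) (x : Plane) : F :=
  derivWithin (fun τ => w τ x) (Ici 0) t

/-- The `L²(ℝ²)` norm. It is only applied to functions that belong to `L²`. -/
def L2norm {F : Type*} [NormedAddCommGroup F] (w : Plane → F) : ℝ :=
  (eLpNorm w 2 volume).toReal

/-- `⟨t⟩_T = e + t/T`. -/
def bracket (T t : ℝ) : ℝ := Real.exp 1 + t / T

/-- Joint smoothness on `[0,∞) × ℝ²`, up to the boundary `t = 0`. -/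
def SmoothField {F : Type*} [NormedAddCommGroup F] [NormedSpace ℝ F]
    (w : ℝ → Plane → F) : Prop :=
  ContDiffOn ℝ ∞ (fun q : ℝ × Plane => w q.1 q.2) (Ici 0 ×ˢ univ)

/-- `w` is smooth in time on `[0,∞)` with values in every Sobolev space `H^k(ℝ²)`, stated for the
pointwise smooth representative: each `∂ₜ^j ∇^k w(t)` is in `L²` and depends continuously on
`t ∈ [0,∞)` in the norm of `L²`. -/
structure SmoothSobolev {F : Type*} [NormedAddCommGroup F] [NormedSpace ℝ F]
    (w : ℝ → Plane → F) : Prop where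
  smooth : SmoothField w
  memLp : ∀ j k : ℕ, ∀ t, 0 ≤ t →
    MemLp (iteratedFDeriv ℝ k (timeDerivN j w t)) 2 volume
  continuous : ∀ j k : ℕ, ∀ t₀, 0 ≤ t₀ →
    Tendsto (fun t => eLpNorm (iteratedFDeriv ℝ k (timeDerivN j w t)
        - iteratedFDeriv ℝ k (timeDerivN j w t₀)) 2 volume) (𝓝[Ici 0] t₀) (𝓝 0)

/-- `(ρ, u, ∇Π)` is a smooth global solution of the two-dimensional inhomogeneous incompressible
Navier–Stokes system; the initial data are `ρ 0` and `u 0`. -/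
structure IsSolINS2D (ρ : ℝ → Plane → ℝ) (u : ℝ → Plane → Plane) (P : ℝ → Plane → ℝ) :
    Prop where
  smooth_rho : SmoothField ρ
  sobolev_u : SmoothSobolev u
  diff_P : ∀ t, 0 ≤ t → Differentiable ℝ (P t)
  sobolev_gradP : SmoothSobolev (fun t => gradient (P t))
  mass : ∀ t, 0 ≤ t → ∀ x, timeDeriv ρ t x + fderiv ℝ (ρ t) x (u t x) = 0
  momentum : ∀ t, 0 ≤ t → ∀ x,
    ρ t x • timeDeriv u t x + ρ t x • fderiv ℝ (u t) x (u t x)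
      - Δ (u t) x + gradient (P t) x = 0
  incompressible : ∀ t, 0 ≤ t → ∀ x, divergence (u t) x = 0

/-- `(ρ, u, v, Π_v, f)` satisfies the linearized system around the smooth global solution
`(ρ, u, ∇Π)`, whose density takes its values in `[1/2, 2]`. -/
structure IsSolLINS2D (ρ : ℝ → Plane → ℝ) (u : ℝ → Plane → Plane) (P : ℝ → Plane → ℝ)
    (v : ℝ → Plane → Plane) (Pv : ℝ → Plane → ℝ) (f : ℝ → Plane → Plane) : Prop where
  base : IsSolINS2D ρ u P
  rho_lower : ∀ t, 0 ≤ t → ∀ x, 1 / 2 ≤ ρ t x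
  rho_upper : ∀ t, 0 ≤ t → ∀ x, ρ t x ≤ 2
  sobolev_v : SmoothSobolev v
  diff_Pv : ∀ t, 0 ≤ t → Differentiable ℝ (Pv t)
  sobolev_gradPv : SmoothSobolev (fun t => gradient (Pv t))
  sobolev_f : SmoothSobolev f
  momentum : ∀ t, 0 ≤ t → ∀ x,
    ρ t x • timeDeriv v t x + ρ t x • fderiv ℝ (v t) x (u t x)
      - Δ (v t) x + gradient (Pv t) x = f t x
  incompressible : ∀ t, 0 ≤ t → ∀ x, divergence (v t) x = 0

/-- `‖√ρ ∂ₜv(t)‖² + ‖∇²v(t)‖² + ‖∇Π_v(t)‖²`, all norms in `L²(ℝ²)`. -/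
def dissipation (ρ : ℝ → Plane → ℝ) (v : ℝ → Plane → Plane) (Pv : ℝ → Plane → ℝ) (t : ℝ) : ℝ :=
  L2norm (fun x => √(ρ t x) • timeDeriv v t x) ^ 2
    + L2norm (grad (grad (v t))) ^ 2 + L2norm (gradient (Pv t)) ^ 2

end

open MeasureTheory Set Filter Topology
open scoped ENNReal ContDiff Laplacian

noncomputable section

/-- The `i`-th partial derivative of a function on the plane. -/
def pd {F : Type*} [NormedAddCommGroup F] [NormedSpace ℝ F] (i : Fin 2) (g : Plane → F)
    (x : Plane) : F := fderiv ℝ g x (basisVec i)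

section Fields

variable {F : Type*} [NormedAddCommGroup F] [NormedSpace ℝ F] {w : ℝ → Plane → F}

lemma uniqueDiffOn_halfSpace : UniqueDiffOn ℝ (Ici (0 : ℝ) ×ˢ (univ : Set Plane)) :=
  (uniqueDiffOn_Ici 0).prod uniqueDiffOn_univ

lemma mem_closure_interior_halfSpace {q : ℝ × Plane} (hq : q ∈ Ici (0 : ℝ) ×ˢ (univ : Set Plane)) :
    q ∈ closure (interior (Ici (0 : ℝ) ×ˢ (univ : Set Plane))) := by
  rw [interior_prod_eq, closure_prod_eq, interior_Ici, interior_univ, closure_Ioi, closure_univ]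
  exact hq

lemma norm_basisVec (i : Fin 2) : ‖basisVec i‖ = 1 := by
  simp [basisVec]

lemma SmoothField.hasFDerivWithinAt (h : SmoothField w) {t : ℝ} (ht : 0 ≤ t) (x : Plane) :
    HasFDerivWithinAt (fun q : ℝ × Plane => w q.1 q.2)
      (fderivWithin ℝ (fun q : ℝ × Plane => w q.1 q.2) (Ici 0 ×ˢ univ) (t, x))
      (Ici 0 ×ˢ univ) (t, x) :=
  ((h.differentiableOn (by simp)) (t, x) ⟨ht, mem_univ _⟩).hasFDerivWithinAt

lemma SmoothField.hasFDerivAt_slice (h : SmoothField w) {t : ℝ} (ht : 0 ≤ t) (x : Plane) :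
    HasFDerivAt (w t)
      ((fderivWithin ℝ (fun q : ℝ × Plane => w q.1 q.2) (Ici 0 ×ˢ univ) (t, x)).comp
        (ContinuousLinearMap.inr ℝ ℝ Plane)) x := by
  have h1 := h.hasFDerivWithinAt ht x
  have h2 : HasFDerivWithinAt (fun y : Plane => (t, y)) (ContinuousLinearMap.inr ℝ ℝ Plane)
      univ x := (hasFDerivAt_prodMk_right t x).hasFDerivWithinAt
  have h3 := HasFDerivWithinAt.comp x h1 h2 (fun y _ => ⟨ht, mem_univ _⟩)
  exact h3.hasFDerivAt univ_mem

lemma SmoothField.hasDerivWithinAt_time (h : SmoothField w) {t : ℝ} (ht : 0 ≤ t) (x : Plane) :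
    HasDerivWithinAt (fun τ => w τ x)
      (fderivWithin ℝ (fun q : ℝ × Plane => w q.1 q.2) (Ici 0 ×ˢ univ) (t, x) (1, 0))
      (Ici 0) t := by
  have h1 := h.hasFDerivWithinAt ht x
  have h2 : HasFDerivWithinAt (fun τ : ℝ => (τ, x)) (ContinuousLinearMap.inl ℝ ℝ Plane)
      (Ici 0) t := (hasFDerivAt_prodMk_left t x).hasFDerivWithinAt
  have h3 := HasFDerivWithinAt.comp t h1 h2
    (show MapsTo (fun τ : ℝ => (τ, x)) (Ici 0) (Ici 0 ×ˢ univ) from fun y hy => ⟨hy, mem_univ _⟩)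
  have h4 := h3.hasDerivWithinAt
  simp only [ContinuousLinearMap.comp_apply, ContinuousLinearMap.inl_apply] at h4
  exact h4

lemma SmoothField.pd_eq (h : SmoothField w) (i : Fin 2) {t : ℝ} (ht : 0 ≤ t) (x : Plane) :
    pd i (w t) x = fderivWithin ℝ (fun q : ℝ × Plane => w q.1 q.2) (Ici 0 ×ˢ univ) (t, x)
      (0, basisVec i) := by
  rw [pd, (h.hasFDerivAt_slice ht x).fderiv]; simp

lemma SmoothField.timeDeriv_eq (h : SmoothField w) {t : ℝ} (ht : 0 ≤ t) (x : Plane) :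
    timeDeriv w t x = fderivWithin ℝ (fun q : ℝ × Plane => w q.1 q.2) (Ici 0 ×ˢ univ) (t, x)
      (1, 0) :=
  (h.hasDerivWithinAt_time ht x).derivWithin (uniqueDiffOn_Ici 0 t ht)

lemma SmoothField.hasDerivWithinAt (h : SmoothField w) {t : ℝ} (ht : 0 ≤ t) (x : Plane) :
    HasDerivWithinAt (fun τ => w τ x) (timeDeriv w t x) (Ici 0) t := by
  rw [h.timeDeriv_eq ht]; exact h.hasDerivWithinAt_time ht x

lemma SmoothField.hasDerivAt (h : SmoothField w) {t : ℝ} (ht : 0 < t) (x : Plane) :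
    HasDerivAt (fun τ => w τ x) (timeDeriv w t x) t :=
  (h.hasDerivWithinAt ht.le x).hasDerivAt (Ici_mem_nhds ht)

lemma SmoothField.fderivWithin_apply (h : SmoothField w) (a : ℝ × Plane) :
    ContDiffOn ℝ ∞ (fun q => fderivWithin ℝ (fun q : ℝ × Plane => w q.1 q.2) (Ici 0 ×ˢ univ) q a)
      (Ici 0 ×ˢ univ) :=
  (ContDiffOn.fderivWithin (m := ∞) h uniqueDiffOn_halfSpace (by simp)).clm_apply contDiffOn_const

lemma SmoothField.pd (h : SmoothField w) (i : Fin 2) : SmoothField (fun t => pd i (w t)) :=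
  (h.fderivWithin_apply (0, basisVec i)).congr fun q hq => h.pd_eq i hq.1 q.2

lemma SmoothField.timeDeriv (h : SmoothField w) : SmoothField (timeDeriv w) :=
  (h.fderivWithin_apply (1, 0)).congr fun q hq => h.timeDeriv_eq hq.1 q.2

lemma SmoothField.contDiff (h : SmoothField w) {t : ℝ} (ht : 0 ≤ t) : ContDiff ℝ ∞ (w t) := by
  rw [← contDiffOn_univ]
  exact ContDiffOn.comp (t := Ici 0 ×ˢ univ) (g := fun q : ℝ × Plane => w q.1 q.2)
    (f := fun y : Plane => (t, y)) h (contDiff_prodMk_right t).contDiffOn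
    (fun y _ => ⟨ht, mem_univ _⟩)

lemma SmoothField.continuousOn_time (h : SmoothField w) (x : Plane) :
    ContinuousOn (fun t => w t x) (Ici 0) :=
  fun _ ht => (h.hasDerivWithinAt ht x).continuousWithinAt

lemma SmoothField.timeDeriv_pd (h : SmoothField w) (i : Fin 2) {t : ℝ} (ht : 0 ≤ t) :
    _root_.timeDeriv (fun t => _root_.pd i (w t)) t = _root_.pd i (_root_.timeDeriv w t) := by
  ext1 x
  rw [(h.pd i).timeDeriv_eq ht, h.timeDeriv.pd_eq i ht]
  set W := fun q : ℝ × Plane => w q.1 q.2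
  set S := Ici (0 : ℝ) ×ˢ (univ : Set Plane)
  have hq : (t, x) ∈ S := ⟨ht, mem_univ _⟩
  have hd : DifferentiableWithinAt ℝ (fderivWithin ℝ W S) S (t, x) :=
    (ContDiffOn.fderivWithin (m := ∞) h uniqueDiffOn_halfSpace (by simp)).differentiableOn
      (by simp) _ hq
  have key : ∀ a : ℝ × Plane, fderivWithin ℝ (fun q => fderivWithin ℝ W S q a) S (t, x) =
      (fderivWithin ℝ (fderivWithin ℝ W S) S (t, x)).flip a := by
    intro a
    have := (hd.hasFDerivWithinAt.clm_apply (hasFDerivWithinAt_const a (t, x) S)).fderivWithin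
      (uniqueDiffOn_halfSpace _ hq)
    rw [this]; ext b <;> simp
  have e1 : fderivWithin ℝ (fun q : ℝ × Plane => _root_.pd i (w q.1) q.2) S (t, x) =
      fderivWithin ℝ (fun q => fderivWithin ℝ W S q (0, basisVec i)) S (t, x) :=
    fderivWithin_congr (fun q hq => h.pd_eq i hq.1 q.2) (h.pd_eq i ht x)
  have e2 : fderivWithin ℝ (fun q : ℝ × Plane => _root_.timeDeriv w q.1 q.2) S (t, x) =
      fderivWithin ℝ (fun q => fderivWithin ℝ W S q (1, 0)) S (t, x) :=
    fderivWithin_congr (fun q hq => h.timeDeriv_eq hq.1 q.2) (h.timeDeriv_eq ht x)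
  rw [e1, e2, key, key]
  have hs : IsSymmSndFDerivWithinAt ℝ W S (t, x) :=
    (h _ hq).isSymmSndFDerivWithinAt
      (by rw [minSmoothness_of_isRCLikeNormedField]; exact WithTop.coe_le_coe.2 le_top)
      uniqueDiffOn_halfSpace (mem_closure_interior_halfSpace hq) hq
  exact hs.eq _ _

lemma timeDerivN_zero : timeDerivN 0 w = w := by
  ext t x; simp [timeDerivN]

lemma timeDerivN_succ (j : ℕ) : timeDerivN (j + 1) w = timeDeriv (timeDerivN j w) := by
  ext t x; simp only [timeDerivN, timeDeriv, iteratedDerivWithin_succ]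

lemma timeDerivN_timeDeriv (j : ℕ) : timeDerivN j (timeDeriv w) = timeDerivN (j + 1) w := by
  ext t x; simp only [timeDerivN, iteratedDerivWithin_succ']; rfl

lemma SmoothField.timeDerivN (h : SmoothField w) (j : ℕ) : SmoothField (timeDerivN j w) := by
  induction j with
  | zero => rwa [timeDerivN_zero]
  | succ j ih => rw [timeDerivN_succ]; exact ih.timeDeriv

lemma SmoothField.timeDerivN_pd (h : SmoothField w) (i : Fin 2) (j : ℕ) {t : ℝ} (ht : 0 ≤ t) :
    _root_.timeDerivN j (fun t => _root_.pd i (w t)) t = _root_.pd i (_root_.timeDerivN j w t) := by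
  induction j generalizing t with
  | zero => simp only [timeDerivN_zero]
  | succ j ih =>
    rw [timeDerivN_succ, timeDerivN_succ, ← (h.timeDerivN j).timeDeriv_pd i ht]
    ext1 x
    exact derivWithin_congr (fun τ hτ => by rw [ih hτ]) (by rw [ih ht])

lemma norm_iteratedFDeriv_pd_le {g : Plane → F} (hg : ContDiff ℝ ∞ g) (i : Fin 2) (k : ℕ)
    (x : Plane) : ‖iteratedFDeriv ℝ k (pd i g) x‖ ≤ ‖iteratedFDeriv ℝ (k + 1) g x‖ := by
  have h1 : ContDiff ℝ ∞ (fderiv ℝ g) := hg.fderiv_right (m := ∞) (by simp)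
  have h2 : pd i g = (ContinuousLinearMap.apply ℝ F (basisVec i)) ∘ fderiv ℝ g := by
    ext x; simp [pd]
  rw [h2]
  refine (ContinuousLinearMap.norm_iteratedFDeriv_comp_left _ (N := ∞) h1.contDiffAt
    (by exact_mod_cast le_top)).trans ?_
  rw [norm_iteratedFDeriv_fderiv]
  refine mul_le_of_le_one_left (norm_nonneg _) ?_
  refine ContinuousLinearMap.opNorm_le_bound _ zero_le_one fun L => ?_
  simpa [norm_basisVec] using L.le_opNorm (basisVec i)

lemma contDiff_pd {g : Plane → F} (hg : ContDiff ℝ ∞ g) (i : Fin 2) : ContDiff ℝ ∞ (pd i g) :=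
  (hg.fderiv_right (m := ∞) (by simp)).clm_apply contDiff_const

lemma pd_sub {g h : Plane → F} (hg : ContDiff ℝ ∞ g) (hh : ContDiff ℝ ∞ h) (i : Fin 2) :
    pd i (g - h) = pd i g - pd i h := by
  ext1 x
  simp only [pd, Pi.sub_apply]
  rw [fderiv_sub (hg.differentiable (by simp) x) (hh.differentiable (by simp) x)]
  rfl

lemma SmoothSobolev.pd (h : SmoothSobolev w) (i : Fin 2) : SmoothSobolev (fun t => pd i (w t)) where
  smooth := h.smooth.pd i
  memLp j k t ht := by
    have hc : ContDiff ℝ ∞ (timeDerivN j w t) := (h.smooth.timeDerivN j).contDiff ht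
    rw [h.smooth.timeDerivN_pd i j ht]
    refine (h.memLp j (k + 1) t ht).mono ?_
      (Eventually.of_forall (norm_iteratedFDeriv_pd_le hc i k))
    exact ((contDiff_pd hc i).continuous_iteratedFDeriv
      (by exact_mod_cast le_top)).aestronglyMeasurable
  continuous j k t₀ ht₀ := by
    refine tendsto_of_tendsto_of_tendsto_of_le_of_le' tendsto_const_nhds
      (h.continuous j (k + 1) t₀ ht₀) (Eventually.of_forall fun _ => zero_le) ?_
    filter_upwards [self_mem_nhdsWithin] with t ht
    have hc : ContDiff ℝ ∞ (timeDerivN j w t) := (h.smooth.timeDerivN j).contDiff ht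
    have hc₀ : ContDiff ℝ ∞ (timeDerivN j w t₀) := (h.smooth.timeDerivN j).contDiff ht₀
    rw [h.smooth.timeDerivN_pd i j ht, h.smooth.timeDerivN_pd i j ht₀,
      ← iteratedFDeriv_sub ((contDiff_pd hc i).of_le (by exact_mod_cast le_top))
        ((contDiff_pd hc₀ i).of_le (by exact_mod_cast le_top)), ← pd_sub hc hc₀,
      ← iteratedFDeriv_sub (hc.of_le (by exact_mod_cast le_top))
        (hc₀.of_le (by exact_mod_cast le_top))]
    exact eLpNorm_mono (norm_iteratedFDeriv_pd_le (hc.sub hc₀) i k)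

lemma SmoothSobolev.timeDeriv (h : SmoothSobolev w) : SmoothSobolev (timeDeriv w) where
  smooth := h.smooth.timeDeriv
  memLp j k t ht := by rw [timeDerivN_timeDeriv]; exact h.memLp (j + 1) k t ht
  continuous j k t₀ ht₀ := by
    simp only [timeDerivN_timeDeriv]; exact h.continuous (j + 1) k t₀ ht₀

lemma SmoothSobolev.contDiff (h : SmoothSobolev w) {t : ℝ} (ht : 0 ≤ t) : ContDiff ℝ ∞ (w t) :=
  h.smooth.contDiff ht

lemma SmoothSobolev.memLp_two (h : SmoothSobolev w) {t : ℝ} (ht : 0 ≤ t) :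
    MemLp (w t) 2 volume := by
  have := h.memLp 0 0 t ht
  rw [timeDerivN_zero] at this
  exact this.of_le (h.contDiff ht).continuous.aestronglyMeasurable
    (Eventually.of_forall fun x => norm_iteratedFDeriv_zero.ge)

lemma SmoothSobolev.tendsto_eLpNorm (h : SmoothSobolev w) {t₀ : ℝ} (ht₀ : 0 ≤ t₀) :
    Tendsto (fun t => eLpNorm (w t - w t₀) 2 volume) (𝓝[Ici 0] t₀) (𝓝 0) := by
  refine (h.continuous 0 0 t₀ ht₀).congr fun t => ?_
  rw [timeDerivN_zero]
  refine eLpNorm_congr_norm_ae (Eventually.of_forall fun x => ?_)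
  rw [Pi.sub_apply, Pi.sub_apply, iteratedFDeriv_zero_eq_comp, iteratedFDeriv_zero_eq_comp,
    Function.comp_apply, Function.comp_apply, ← map_sub, LinearIsometryEquiv.norm_map]

lemma smoothSobolev_zero : SmoothSobolev (fun _ _ => 0 : ℝ → Plane → F) := by
  have h0 : ∀ j, timeDerivN j (fun _ _ => 0 : ℝ → Plane → F) = fun _ _ => 0 := by
    intro j
    induction j with
    | zero => exact timeDerivN_zero
    | succ j ih => rw [timeDerivN_succ, ih]; ext t x; simp [_root_.timeDeriv]
  refine ⟨contDiffOn_const, fun j k t ht => ?_, fun j k t ht => ?_⟩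
  · rw [h0]; simp
  · simp only [h0]; simpa using tendsto_const_nhds

end Fields

section Static

variable {F : Type*} [NormedAddCommGroup F]

lemma sq_L2norm {g : Plane → F} (hg : MemLp g 2 volume) : L2norm g ^ 2 = ∫ x, ‖g x‖ ^ 2 := by
  rw [L2norm, hg.eLpNorm_eq_integral_rpow_norm (by simp) (by simp), ENNReal.toReal_ofReal
    (by positivity)]
  simp only [ENNReal.toReal_ofNat, Real.rpow_ofNat]
  rw [← Real.rpow_natCast, ← Real.rpow_mul (by positivity)]
  norm_num

lemma MemLp.integrable_norm_sq {g : Plane → F} (hg : MemLp g 2 volume) :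
    Integrable (fun x => ‖g x‖ ^ 2) :=
  (memLp_two_iff_integrable_sq_norm hg.1).1 hg

lemma MemLp.integrable_norm_mul_norm {G : Type*} [NormedAddCommGroup G] {g : Plane → F}
    {h : Plane → G} (hg : MemLp g 2 volume) (hh : MemLp h 2 volume) :
    Integrable (fun x => ‖g x‖ * ‖h x‖) :=
  hg.norm.integrable_mul hh.norm

lemma sq_integral_norm_mul_norm_le {G : Type*} [NormedAddCommGroup G] {g : Plane → F}
    {h : Plane → G} (hg : MemLp g 2 volume) (hh : MemLp h 2 volume) :
    (∫ x, ‖g x‖ * ‖h x‖) ^ 2 ≤ (∫ x, ‖g x‖ ^ 2) * ∫ x, ‖h x‖ ^ 2 := by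
  have := integral_mul_norm_le_Lp_mul_Lq (μ := volume) (f := fun x => ‖g x‖)
    (g := fun x => ‖h x‖) (p := 2) (q := 2) Real.HolderConjugate.two_two
    (by simpa using hg.norm) (by simpa using hh.norm)
  simp only [Real.rpow_ofNat, norm_norm] at this
  have h0 : 0 ≤ ∫ x, ‖g x‖ * ‖h x‖ := integral_nonneg fun x => by positivity
  have h1 : 0 ≤ ∫ x, ‖g x‖ ^ 2 := integral_nonneg fun x => by positivity
  have h2 : 0 ≤ ∫ x, ‖h x‖ ^ 2 := integral_nonneg fun x => by positivity
  calc _ ≤ _ := pow_le_pow_left₀ h0 this 2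
    _ = _ := by
      rw [mul_pow, ← Real.sqrt_eq_rpow, ← Real.sqrt_eq_rpow, Real.sq_sqrt h1, Real.sq_sqrt h2]

variable {E : Type*} [NormedAddCommGroup E] [InnerProductSpace ℝ E]

lemma MemLp.integrable_inner {g h : Plane → E} (hg : MemLp g 2 volume) (hh : MemLp h 2 volume) :
    Integrable (fun x => inner ℝ (g x) (h x)) :=
  (MemLp.integrable_norm_mul_norm hg hh).mono' (hg.1.inner hh.1)
    (Eventually.of_forall fun _ => norm_inner_le_norm _ _)

/-- Smooth functions that belong to `H¹(ℝ²)`. -/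
structure IsH1 {F : Type*} [NormedAddCommGroup F] [NormedSpace ℝ F] (g : Plane → F) : Prop where
  contDiff : ContDiff ℝ ∞ g
  memLp : MemLp g 2 volume
  memLp_pd : ∀ i, MemLp (pd i g) 2 volume

lemma SmoothSobolev.isH1 {F : Type*} [NormedAddCommGroup F] [NormedSpace ℝ F]
    {w : ℝ → Plane → F} (h : SmoothSobolev w) {t : ℝ} (ht : 0 ≤ t) : IsH1 (w t) :=
  ⟨h.contDiff ht, h.memLp_two ht, fun i => (h.pd i).memLp_two ht⟩

lemma pd_clm {F G : Type*} [NormedAddCommGroup F] [NormedSpace ℝ F] [NormedAddCommGroup G]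
    [NormedSpace ℝ G] (L : F →L[ℝ] G) {g : Plane → F} (hg : ContDiff ℝ ∞ g) (i : Fin 2) :
    pd i (fun x => L (g x)) = fun x => L (pd i g x) := by
  ext1 x
  have := L.hasFDerivAt.comp x (hg.differentiable (by simp) x).hasFDerivAt
  exact congrArg (fun A => A (basisVec i)) this.fderiv

lemma IsH1.clm {F G : Type*} [NormedAddCommGroup F] [NormedSpace ℝ F] [NormedAddCommGroup G]
    [NormedSpace ℝ G] {g : Plane → F} (hg : IsH1 g) (L : F →L[ℝ] G) :
    IsH1 (fun x => L (g x)) where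
  contDiff := L.contDiff.comp hg.contDiff
  memLp := L.comp_memLp' hg.memLp
  memLp_pd i := by rw [pd_clm L hg.contDiff]; exact L.comp_memLp' (hg.memLp_pd i)

lemma IsH1.integral_inner_pd {g h : Plane → E} (hg : IsH1 g) (hh : IsH1 h) (i : Fin 2) :
    ∫ x, inner ℝ (g x) (pd i h x) = - ∫ x, inner ℝ (pd i g x) (h x) :=
  integral_bilinear_fderiv_right_eq_neg_left_of_integrable (B := innerSL ℝ) (v := basisVec i)
    (MemLp.integrable_inner (hg.memLp_pd i) hh.memLp)
    (MemLp.integrable_inner hg.memLp (hh.memLp_pd i))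
    (MemLp.integrable_inner hg.memLp hh.memLp)
    (fun x _ => hg.contDiff.differentiable (by simp) x)
    (fun x _ => hh.contDiff.differentiable (by simp) x)

lemma pd_comm {F : Type*} [NormedAddCommGroup F] [NormedSpace ℝ F] {g : Plane → F}
    (hg : ContDiff ℝ ∞ g) (i j : Fin 2) : pd i (pd j g) = pd j (pd i g) := by
  have hd : Differentiable ℝ (fderiv ℝ g) :=
    (hg.fderiv_right (m := ∞) (by simp)).differentiable (by simp)
  have key : ∀ i j x, pd i (pd j g) x = fderiv ℝ (fderiv ℝ g) x (basisVec i) (basisVec j) := by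
    intro i j x
    have := ((hd x).hasFDerivAt.clm_apply (hasFDerivAt_const (basisVec j) x)).fderiv
    have h2 := congrArg (fun A => A (basisVec i)) this
    simpa using! h2
  ext1 x
  rw [key, key]
  exact (hg.contDiffAt.isSymmSndFDerivAt
    (by rw [minSmoothness_of_isRCLikeNormedField]; exact WithTop.coe_le_coe.2 le_top)).eq _ _

lemma laplacian_eq_sum_pd {F : Type*} [NormedAddCommGroup F] [NormedSpace ℝ F] {g : Plane → F}
    (hg : ContDiff ℝ ∞ g) (x : Plane) : Δ g x = ∑ i, pd i (pd i g) x := by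
  have hd : Differentiable ℝ (fderiv ℝ g) :=
    (hg.fderiv_right (m := ∞) (by simp)).differentiable (by simp)
  rw [InnerProductSpace.laplacian_eq_iteratedFDeriv_orthonormalBasis g
    (EuclideanSpace.basisFun (Fin 2) ℝ)]
  refine Finset.sum_congr rfl fun i _ => ?_
  have := ((hd x).hasFDerivAt.clm_apply (hasFDerivAt_const (basisVec i) x)).fderiv
  have h2 := congrArg (fun A => A (basisVec i)) this
  rw [iteratedFDeriv_two_apply]
  simpa [basisVec] using! h2.symm

lemma sq_L2norm_grad {g : Plane → E} (hg : IsH1 g) :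
    L2norm (grad g) ^ 2 = ∑ i, ∫ x, ‖pd i g x‖ ^ 2 := by
  have hm : MemLp (grad g) 2 volume := by
    rw [memLp_piLp_iff]
    exact hg.memLp_pd
  rw [sq_L2norm hm, ← integral_finsetSum _ fun i _ => MemLp.integrable_norm_sq (hg.memLp_pd i)]
  refine integral_congr_ae (Eventually.of_forall fun x => ?_)
  simp only [PiLp.norm_sq_eq_of_L2]
  rfl

lemma grad_isH1 {g : Plane → E} (hg : ContDiff ℝ ∞ g) (h : ∀ i, IsH1 (pd i g)) :
    IsH1 (grad g) ∧ ∀ i x, pd i (grad g) x = WithLp.toLp 2 fun j => pd i (pd j g) x := by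
  have hc : ContDiff ℝ ∞ (grad g) := by
    rw [contDiff_piLp]
    exact fun j => contDiff_pd hg j
  have hp : ∀ i x, pd i (grad g) x = WithLp.toLp 2 fun j => pd i (pd j g) x := by
    intro i x
    ext j
    have := congrFun (pd_clm (PiLp.proj 2 (𝕜 := ℝ) (fun _ : Fin 2 => E) j) hc i) x
    exact this.symm
  refine ⟨⟨hc, ?_, fun i => ?_⟩, hp⟩
  · rw [memLp_piLp_iff]; exact fun j => (h j).memLp
  · rw [funext (hp i), memLp_piLp_iff]; exact fun j => (h j).memLp_pd i

lemma sq_L2norm_grad_grad {g : Plane → E} (hg : ContDiff ℝ ∞ g) (h : ∀ i, IsH1 (pd i g)) :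
    L2norm (grad (grad g)) ^ 2 = ∑ i, ∑ j, ∫ x, ‖pd i (pd j g) x‖ ^ 2 := by
  obtain ⟨h1, hp⟩ := grad_isH1 hg h
  rw [sq_L2norm_grad h1]
  refine Finset.sum_congr rfl fun i _ => ?_
  rw [← integral_finsetSum _ fun j _ => MemLp.integrable_norm_sq ((h j).memLp_pd i)]
  refine integral_congr_ae (Eventually.of_forall fun x => ?_)
  simp only [hp, PiLp.norm_sq_eq_of_L2]

/-- `‖∇²g‖ = ‖Δg‖` in `L²(ℝ²)`. -/
lemma sum_integral_pd_pd_eq {g : Plane → E} (h : ∀ i, IsH1 (pd i g)) (hg : ContDiff ℝ ∞ g)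
    (h2 : ∀ i j, IsH1 (pd i (pd j g))) :
    ∑ i, ∑ j, ∫ x, ‖pd i (pd j g) x‖ ^ 2 = ∫ x, ‖∑ i, pd i (pd i g) x‖ ^ 2 := by
  have key : ∀ i j, ∫ x, ‖pd i (pd j g) x‖ ^ 2 =
      ∫ x, inner ℝ (pd i (pd i g) x) (pd j (pd j g) x) := by
    intro i j
    have e1 : ∫ x, ‖pd i (pd j g) x‖ ^ 2 = ∫ x, inner ℝ (pd i (pd j g) x) (pd i (pd j g) x) := by
      simp only [real_inner_self_eq_norm_sq]
    rw [e1, (h2 i j).integral_inner_pd (h j) i]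
    have e2 : pd i (pd i (pd j g)) = pd j (pd i (pd i g)) := by
      rw [pd_comm hg i j, pd_comm (contDiff_pd hg i) i j]
    rw [e2, (h2 i i).integral_inner_pd (h j) j]
  simp only [key]
  have hi : ∀ i j, Integrable (fun x => inner ℝ (pd i (pd i g) x) (pd j (pd j g) x)) :=
    fun i j => MemLp.integrable_inner (h2 i i).memLp (h2 j j).memLp
  simp only [← integral_finsetSum Finset.univ fun j _ => hi _ j]
  rw [← integral_finsetSum _ fun i _ => integrable_finsetSum _ fun j _ => hi i j]
  refine integral_congr_ae (Eventually.of_forall fun x => ?_)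
  simp only [← real_inner_self_eq_norm_sq, sum_inner, inner_sum]
  exact Finset.sum_comm

end Static

section TimeContinuity

/-- Jointly continuous fields on `[0,∞) × ℝ²` that are continuous in time with values in `L²`. -/
structure L2Field {F : Type*} [NormedAddCommGroup F] (w : ℝ → Plane → F) : Prop where
  continuousOn : ContinuousOn (fun q : ℝ × Plane => w q.1 q.2) (Ici 0 ×ˢ univ)
  memLp : ∀ {t}, 0 ≤ t → MemLp (w t) 2 volume
  tendsto : ∀ {t₀}, 0 ≤ t₀ →
    Tendsto (fun t => eLpNorm (w t - w t₀) 2 volume) (𝓝[Ici 0] t₀) (𝓝 0)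

lemma SmoothSobolev.l2Field {F : Type*} [NormedAddCommGroup F] [NormedSpace ℝ F]
    {w : ℝ → Plane → F} (h : SmoothSobolev w) : L2Field w :=
  ⟨ContDiffOn.continuousOn h.smooth, h.memLp_two, h.tendsto_eLpNorm⟩

lemma L2Field.neg {F : Type*} [NormedAddCommGroup F] {p : ℝ → Plane → F} (hp : L2Field p) :
    L2Field (fun t x => - p t x) where
  continuousOn := hp.continuousOn.neg
  memLp ht := (hp.memLp ht).neg
  tendsto {t₀} ht₀ := by
    refine (hp.tendsto ht₀).congr fun t => ?_
    rw [← eLpNorm_neg]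
    congr 1
    ext x
    simp only [Pi.neg_apply, Pi.sub_apply]; abel

lemma L2Field.add {F : Type*} [NormedAddCommGroup F] {p q : ℝ → Plane → F} (hp : L2Field p)
    (hq : L2Field q) : L2Field (fun t x => p t x + q t x) where
  continuousOn := hp.continuousOn.add hq.continuousOn
  memLp ht := (hp.memLp ht).add (hq.memLp ht)
  tendsto {t₀} ht₀ := by
    have h := (hp.tendsto ht₀).add (hq.tendsto ht₀)
    rw [add_zero] at h
    refine tendsto_of_tendsto_of_tendsto_of_le_of_le' tendsto_const_nhds h
      (Eventually.of_forall fun _ => zero_le) ?_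
    filter_upwards [self_mem_nhdsWithin] with t ht
    refine le_trans (le_of_eq ?_) (eLpNorm_add_le ((hp.memLp ht).sub (hp.memLp ht₀)).1
      ((hq.memLp ht).sub (hq.memLp ht₀)).1 one_le_two)
    congr 1
    ext x
    simp only [Pi.add_apply, Pi.sub_apply]; abel

variable {E : Type*} [NormedAddCommGroup E] [InnerProductSpace ℝ E]

lemma L2Field.continuousOn_integral_inner {p q : ℝ → Plane → E} (hp : L2Field p)
    (hq : L2Field q) : ContinuousOn (fun t => ∫ x, inner ℝ (p t x) (q t x)) (Ici 0) := by
  rw [continuousOn_iff_continuous_domRestrict]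
  have hc : ∀ {w : ℝ → Plane → E} (hw : L2Field w),
      Continuous (fun t : Ici (0 : ℝ) => (hw.memLp t.2).toLp (w t)) := by
    intro w hw
    rw [continuous_iff_continuousAt]
    rintro ⟨t₀, ht₀⟩
    refine (Lp.tendsto_Lp_iff_tendsto_eLpNorm'' _ (fun t : Ici (0 : ℝ) => hw.memLp t.2) _
      (hw.memLp ht₀)).2 ?_
    rw [nhds_subtype_eq_comap_nhdsWithin]
    exact (hw.tendsto ht₀).comp tendsto_comap
  refine ((hc hp).inner (hc hq)).congr fun t => ?_
  rw [L2.inner_def]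
  refine integral_congr_ae ?_
  filter_upwards [(hp.memLp t.2).coeFn_toLp, (hq.memLp t.2).coeFn_toLp] with x h1 h2
  rw [h1, h2]

lemma L2Field.continuousOn_integral_sq {p : ℝ → Plane → E} (hp : L2Field p) :
    ContinuousOn (fun t => ∫ x, ‖p t x‖ ^ 2) (Ici 0) := by
  simpa only [real_inner_self_eq_norm_sq] using hp.continuousOn_integral_inner hp

end TimeContinuity

section Cutoff

/-- A smooth bump equal to `1` on the unit ball and supported in the ball of radius `2`. -/
def planeBump : ContDiffBump (0 : Plane) := ⟨1, 2, one_pos, one_lt_two⟩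

/-- The cutoff at scale `n + 1`. -/
def cutoff (n : ℕ) (x : Plane) : ℝ := planeBump (((n : ℝ) + 1)⁻¹ • x)

lemma contDiff_cutoff (n : ℕ) : ContDiff ℝ ∞ (cutoff n) :=
  planeBump.contDiff.comp (contDiff_const_smul _)

lemma hasCompactSupport_cutoff (n : ℕ) : HasCompactSupport (cutoff n) :=
  planeBump.hasCompactSupport.comp_homeomorph
    (Homeomorph.smulOfNeZero ((n : ℝ) + 1)⁻¹ (by positivity))

lemma cutoff_nonneg (n : ℕ) (x : Plane) : 0 ≤ cutoff n x := planeBump.nonneg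

lemma cutoff_le_one (n : ℕ) (x : Plane) : cutoff n x ≤ 1 := planeBump.le_one

lemma tendsto_inv_smul_zero (x : Plane) :
    Tendsto (fun n : ℕ => ((n : ℝ) + 1)⁻¹ • x) atTop (𝓝 0) := by
  have h := (tendsto_one_div_add_atTop_nhds_zero_nat (𝕜 := ℝ)).smul_const x
  simpa using h

lemma tendsto_cutoff (x : Plane) : Tendsto (fun n => cutoff n x) atTop (𝓝 1) := by
  have h := (planeBump.continuous.tendsto 0).comp (tendsto_inv_smul_zero x)
  rwa [planeBump.one_of_mem_closedBall (by simp [planeBump])] at h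

lemma exists_fderiv_cutoff_le :
    ∃ M : ℝ, 0 ≤ M ∧ ∀ n x, ‖fderiv ℝ (cutoff n) x‖ ≤ M * ((n : ℝ) + 1)⁻¹ := by
  obtain ⟨M, hM⟩ := (planeBump.hasCompactSupport.fderiv (𝕜 := ℝ)).exists_bound_of_continuous
    (planeBump.contDiff.continuous_fderiv (n := ∞) (by simp))
  refine ⟨M, (norm_nonneg _).trans (hM 0), fun n x => ?_⟩
  have hd : DifferentiableAt ℝ planeBump (((n : ℝ) + 1)⁻¹ • x) :=
    planeBump.contDiff.differentiable (n := ∞) (by simp) _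
  have h := (hd.hasFDerivAt.comp x ((hasFDerivAt_id x).const_smul ((n : ℝ) + 1)⁻¹)).fderiv
  have h2 : fderiv ℝ (cutoff n) x = ((n : ℝ) + 1)⁻¹ • fderiv ℝ planeBump (((n : ℝ) + 1)⁻¹ • x) := by
    refine (show fderiv ℝ (cutoff n) x = _ from h).trans ?_
    ext y; simp
  rw [h2, norm_smul, Real.norm_of_nonneg (by positivity), mul_comm]
  exact mul_le_mul_of_nonneg_right (hM _) (by positivity)

lemma plane_eq_sum (y : Plane) : y = ∑ i, y i • basisVec i := by
  ext j; fin_cases j <;> simp [basisVec]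

lemma abs_apply_le_norm (y : Plane) (i : Fin 2) : |y i| ≤ ‖y‖ := by
  simpa using PiLp.norm_apply_le y i

lemma fderiv_apply_eq_sum {F : Type*} [NormedAddCommGroup F] [NormedSpace ℝ F] (g : Plane → F)
    (x y : Plane) : fderiv ℝ g x y = ∑ i, y i • pd i g x := by
  conv_lhs => rw [plane_eq_sum y]
  simp [pd]

lemma norm_fderiv_le_sum {F : Type*} [NormedAddCommGroup F] [NormedSpace ℝ F] (g : Plane → F)
    (x : Plane) : ‖fderiv ℝ g x‖ ≤ ∑ i, ‖pd i g x‖ := by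
  refine ContinuousLinearMap.opNorm_le_bound _ (by positivity) fun y => ?_
  rw [fderiv_apply_eq_sum, Finset.sum_mul]
  refine norm_sum_le_of_le _ fun i _ => ?_
  rw [norm_smul, mul_comm, Real.norm_eq_abs]
  exact mul_le_mul_of_nonneg_left (abs_apply_le_norm y i) (norm_nonneg _)

end Cutoff

section Ladyzhenskaya

variable {E : Type*} [NormedAddCommGroup E] [InnerProductSpace ℝ E]

/-- The constant in Ladyzhenskaya's inequality. -/
def ladyConst : ℝ := 8 * (eLpNormLESNormFDerivOneConst (volume : Measure Plane) 2 : ℝ) ^ 2 + 1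

lemma ladyConst_pos : 0 < ladyConst := by unfold ladyConst; positivity

lemma holderConjugate_finrank_plane : NNReal.HolderConjugate (Module.finrank ℝ Plane) 2 := by
  rw [finrank_euclideanSpace_fin]
  exact_mod_cast (NNReal.HolderConjugate.two_two)

lemma eLpNorm_cutoff_mul_sq_le {g : Plane → E} (hg : IsH1 g) {M : ℝ} (hM0 : 0 ≤ M)
    (hM : ∀ n x, ‖fderiv ℝ (cutoff n) x‖ ≤ M * ((n : ℝ) + 1)⁻¹) (n : ℕ) :
    eLpNorm (fun x => cutoff n x * ‖g x‖ ^ 2) 2 volume ≤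
      ENNReal.ofReal (eLpNormLESNormFDerivOneConst (volume : Measure Plane) 2 *
        (M * ((n : ℝ) + 1)⁻¹ * (∫ x, ‖g x‖ ^ 2) + 2 * ∑ i, ∫ x, ‖g x‖ * ‖pd i g x‖)) := by
  have hc : ContDiff ℝ ∞ (fun x => cutoff n x * ‖g x‖ ^ 2) :=
    (contDiff_cutoff n).mul (hg.contDiff.norm_sq ℝ)
  have h1 := eLpNorm_le_eLpNorm_fderiv_one (volume : Measure Plane)
    (hc.of_le (WithTop.coe_le_coe.2 le_top)) ((hasCompactSupport_cutoff n).mul_right)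
    holderConjugate_finrank_plane
  refine (show eLpNorm (fun x => cutoff n x * ‖g x‖ ^ 2) 2 volume ≤ _ from h1).trans ?_
  rw [ENNReal.ofReal_mul NNReal.zero_le_coe, ENNReal.ofReal_coe_nnreal]
  refine mul_le_mul_right ?_ _
  have hi1 := MemLp.integrable_norm_sq hg.memLp
  have hi2 := fun i => MemLp.integrable_norm_mul_norm hg.memLp (hg.memLp_pd i)
  have hI : Integrable (fun x => M * ((n : ℝ) + 1)⁻¹ * ‖g x‖ ^ 2 +
      2 * ∑ i, ‖g x‖ * ‖pd i g x‖) :=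
    (hi1.const_mul _).add ((integrable_finsetSum _ fun i _ => hi2 i).const_mul 2)
  have hle : ∀ x, ‖fderiv ℝ (fun x => cutoff n x * ‖g x‖ ^ 2) x‖ ≤
      M * ((n : ℝ) + 1)⁻¹ * ‖g x‖ ^ 2 + 2 * ∑ i, ‖g x‖ * ‖pd i g x‖ := by
    intro x
    have hd := ((contDiff_cutoff n).differentiable (by simp) x).hasFDerivAt.mul
      ((hg.contDiff.differentiable (by simp) x).hasFDerivAt.norm_sq)
    rw [show fderiv ℝ (fun x => cutoff n x * ‖g x‖ ^ 2) x = _ from hd.fderiv]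
    refine (norm_add_le _ _).trans ?_
    rw [add_comm, norm_smul, norm_smul, ← Nat.cast_smul_eq_nsmul ℝ, norm_smul]
    refine add_le_add ?_ ?_
    · rw [mul_comm]
      refine mul_le_mul (hM n x) ?_ (by positivity) (by positivity)
      simp
    · rw [Real.norm_of_nonneg (cutoff_nonneg n x)]
      refine (mul_le_of_le_one_left (by positivity) (cutoff_le_one n x)).trans ?_
      simp only [Nat.cast_ofNat, Real.norm_ofNat]
      refine mul_le_mul_of_nonneg_left ?_ zero_le_two
      refine (ContinuousLinearMap.opNorm_comp_le _ _).trans ?_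
      rw [← Finset.mul_sum, innerSL_apply_norm]
      exact mul_le_mul_of_nonneg_left (norm_fderiv_le_sum g x) (norm_nonneg _)
  calc _ ≤ eLpNorm (fun x => M * ((n : ℝ) + 1)⁻¹ * ‖g x‖ ^ 2 + 2 * ∑ i, ‖g x‖ * ‖pd i g x‖) 1
        volume := eLpNorm_mono_real hle
    _ = ENNReal.ofReal (∫ x, M * ((n : ℝ) + 1)⁻¹ * ‖g x‖ ^ 2 + 2 * ∑ i, ‖g x‖ * ‖pd i g x‖) := by
      rw [eLpNorm_one_eq_lintegral_enorm, ← ofReal_integral_norm_eq_lintegral_enorm hI]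
      congr 1
      refine integral_congr_ae (Eventually.of_forall fun x => ?_)
      exact Real.norm_of_nonneg (by positivity)
    _ = _ := by
      rw [integral_add (hi1.const_mul _) ((integrable_finsetSum _ fun i _ => hi2 i).const_mul 2),
        integral_const_mul, integral_const_mul, integral_finsetSum _ fun i _ => hi2 i]

/-- Ladyzhenskaya's inequality in the plane. -/
lemma IsH1.ladyzhenskaya {g : Plane → E} (hg : IsH1 g) :
    MemLp (fun x => ‖g x‖ ^ 2) 2 volume ∧
      ∫ x, ‖g x‖ ^ 4 ≤ ladyConst * (∫ x, ‖g x‖ ^ 2) * ∑ i, ∫ x, ‖pd i g x‖ ^ 2 := by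
  obtain ⟨M, hM0, hM⟩ := exists_fderiv_cutoff_le
  set c : ℝ := NNReal.toReal (eLpNormLESNormFDerivOneConst (volume : Measure Plane) 2)
  have hc0 : 0 ≤ c := NNReal.zero_le_coe
  set S := ∑ i, ∫ x, ‖g x‖ * ‖pd i g x‖ with hS
  have hS0 : 0 ≤ S := Finset.sum_nonneg fun i _ => integral_nonneg fun x => by positivity
  have hmeas : AEStronglyMeasurable (fun x => ‖g x‖ ^ 2) volume :=
    (hg.contDiff.continuous.norm.pow 2).aestronglyMeasurable
  have hle : eLpNorm (fun x => ‖g x‖ ^ 2) 2 volume ≤ ENNReal.ofReal (c * (2 * S)) := by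
    refine (Lp.eLpNorm_lim_le_liminf_eLpNorm (f := fun n x => cutoff n x * ‖g x‖ ^ 2)
      (fun n => ?_) _ (Eventually.of_forall fun x => ?_)).trans ?_
    · exact ((contDiff_cutoff n).continuous.mul
        (hg.contDiff.continuous.norm.pow 2)).aestronglyMeasurable
    · simpa using (tendsto_cutoff x).mul_const (‖g x‖ ^ 2)
    · refine (liminf_le_liminf (Eventually.of_forall
        (eLpNorm_cutoff_mul_sq_le hg hM0 hM))).trans_eq ?_
      refine Tendsto.liminf_eq (ENNReal.tendsto_ofReal ?_)
      have h := (tendsto_one_div_add_atTop_nhds_zero_nat (𝕜 := ℝ))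
      have h2 := (((h.const_mul M).mul_const (∫ x, ‖g x‖ ^ 2)).add_const (2 * S)).const_mul c
      simp only [one_div, mul_zero, zero_mul, zero_add] at h2
      exact h2
  have hmem : MemLp (fun x => ‖g x‖ ^ 2) 2 volume :=
    ⟨hmeas, hle.trans_lt ENNReal.ofReal_lt_top⟩
  refine ⟨hmem, ?_⟩
  have h4 : ∫ x, ‖g x‖ ^ 4 = L2norm (fun x => ‖g x‖ ^ 2) ^ 2 := by
    rw [sq_L2norm hmem]
    refine integral_congr_ae (Eventually.of_forall fun x => ?_)
    simp only [norm_pow, norm_norm]; ring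
  have h5 : L2norm (fun x => ‖g x‖ ^ 2) ≤ c * (2 * S) :=
    ENNReal.toReal_le_of_le_ofReal (by positivity) hle
  have h6 : S ^ 2 ≤ 2 * ((∫ x, ‖g x‖ ^ 2) * ∑ i, ∫ x, ‖pd i g x‖ ^ 2) := by
    rw [Finset.mul_sum, hS, Fin.sum_univ_two, Fin.sum_univ_two]
    have a0 := sq_integral_norm_mul_norm_le hg.memLp (hg.memLp_pd 0)
    have a1 := sq_integral_norm_mul_norm_le hg.memLp (hg.memLp_pd 1)
    nlinarith [sq_nonneg ((∫ x, ‖g x‖ * ‖pd 0 g x‖) - ∫ x, ‖g x‖ * ‖pd 1 g x‖)]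
  have h7 : 0 ≤ (∫ x, ‖g x‖ ^ 2) * ∑ i, ∫ x, ‖pd i g x‖ ^ 2 :=
    mul_nonneg (integral_nonneg fun x => by positivity)
      (Finset.sum_nonneg fun i _ => integral_nonneg fun x => by positivity)
  rw [h4]
  calc _ ≤ (c * (2 * S)) ^ 2 := pow_le_pow_left₀ ENNReal.toReal_nonneg h5 2
    _ = 4 * c ^ 2 * S ^ 2 := by ring
    _ ≤ 4 * c ^ 2 * (2 * ((∫ x, ‖g x‖ ^ 2) * ∑ i, ∫ x, ‖pd i g x‖ ^ 2)) :=
      mul_le_mul_of_nonneg_left h6 (by positivity)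
    _ ≤ _ := by unfold ladyConst; nlinarith

/-- `‖g‖_{L⁴}` bounds, combined: the `L²` norm of a product of two `H¹` functions. -/
lemma IsH1.integral_sq_mul_sq_le {G : Type*} [NormedAddCommGroup G] [InnerProductSpace ℝ G]
    {g : Plane → E} {h : Plane → G} (hg : IsH1 g) (hh : IsH1 h) :
    Integrable (fun x => ‖g x‖ ^ 2 * ‖h x‖ ^ 2) ∧
    (∫ x, ‖g x‖ ^ 2 * ‖h x‖ ^ 2) ^ 2 ≤ ladyConst ^ 2 *
      ((∫ x, ‖g x‖ ^ 2) * ∑ i, ∫ x, ‖pd i g x‖ ^ 2) *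
      ((∫ x, ‖h x‖ ^ 2) * ∑ i, ∫ x, ‖pd i h x‖ ^ 2) := by
  obtain ⟨g1, g2⟩ := hg.ladyzhenskaya
  obtain ⟨h1, h2⟩ := hh.ladyzhenskaya
  refine ⟨g1.integrable_mul h1, ?_⟩
  have := sq_integral_norm_mul_norm_le g1 h1
  simp only [norm_pow, norm_norm, ← pow_mul] at this
  norm_num at this
  refine this.trans ((mul_le_mul g2 h2 (integral_nonneg fun x => by positivity) ?_).trans_eq ?_)
  · exact (integral_nonneg fun x => by positivity).trans g2
  · ring

end Ladyzhenskaya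

section Slab

variable {Φ : ℝ → Plane → ℝ} {a b : ℝ}

lemma aestronglyMeasurable_slab (hc : ContinuousOn (fun q : ℝ × Plane => Φ q.1 q.2)
    (Icc a b ×ˢ univ)) :
    AEStronglyMeasurable (fun q : ℝ × Plane => Φ q.1 q.2)
      ((volume.restrict (Ioc a b)).prod volume) := by
  have h1 : (volume.restrict (Ioc a b)).prod (volume : Measure Plane) =
      ((volume : Measure ℝ).prod (volume : Measure Plane)).restrict (Ioc a b ×ˢ univ) := by
    rw [← Measure.prod_restrict, Measure.restrict_univ]
  rw [h1]
  exact (hc.mono (prod_mono Ioc_subset_Icc_self Subset.rfl)).aestronglyMeasurable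
    (measurableSet_Ioc.prod MeasurableSet.univ)

lemma integrable_slab (hc : ContinuousOn (fun q : ℝ × Plane => Φ q.1 q.2) (Icc a b ×ˢ univ))
    (hi : ∀ t ∈ Icc a b, Integrable (Φ t)) {M : ℝ} (hM : ∀ t ∈ Icc a b, ∫ x, ‖Φ t x‖ ≤ M) :
    Integrable (fun q : ℝ × Plane => Φ q.1 q.2) ((volume.restrict (Ioc a b)).prod volume) := by
  have hm := aestronglyMeasurable_slab hc
  rw [integrable_prod_iff hm]
  have hae : ∀ᵐ t ∂(volume.restrict (Ioc a b)), t ∈ Icc a b := by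
    filter_upwards [ae_restrict_mem measurableSet_Ioc] with t ht using Ioc_subset_Icc_self ht
  refine ⟨hae.mono hi, ?_⟩
  refine Integrable.mono' (integrable_const M) hm.norm.integral_prod_right' ?_
  filter_upwards [hae] with t ht
  rw [Real.norm_of_nonneg (integral_nonneg fun x => norm_nonneg _)]
  exact hM t ht

lemma intervalIntegrable_slab (hab : a ≤ b)
    (h : Integrable (fun q : ℝ × Plane => Φ q.1 q.2) ((volume.restrict (Ioc a b)).prod volume)) :
    IntervalIntegrable (fun t => ∫ x, Φ t x) volume a b := by
  rw [intervalIntegrable_iff_integrableOn_Ioc_of_le hab]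
  exact h.integral_prod_left

lemma integral_slab (hab : a ≤ b)
    (h : Integrable (fun q : ℝ × Plane => Φ q.1 q.2) ((volume.restrict (Ioc a b)).prod volume)) :
    ∫ q, Φ q.1 q.2 ∂((volume.restrict (Ioc a b)).prod volume) = ∫ t in a..b, ∫ x, Φ t x := by
  rw [intervalIntegral.integral_of_le hab, integral_prod _ h]

lemma integral_eq_integral_slab (hab : a ≤ b)
    (h : Integrable (fun q : ℝ × Plane => Φ q.1 q.2) ((volume.restrict (Ioc a b)).prod volume))
    {g : Plane → ℝ} (hg : ∀ x, g x = ∫ t in a..b, Φ t x) :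
    ∫ x, g x = ∫ t in a..b, ∫ x, Φ t x := by
  simp only [hg, intervalIntegral.integral_of_le hab]
  rw [integral_integral_swap]
  exact h.swap

end Slab

section Pressure

variable {h w : Plane → Plane}

lemma inner_plane (y z : Plane) : inner ℝ y z = ∑ j, y j * z j := by
  simp [PiLp.inner_apply, mul_comm]

lemma pd_apply {g : Plane → Plane} (hg : ContDiff ℝ ∞ g) (i j : Fin 2) (x : Plane) :
    pd i (fun x => g x j) x = pd i g x j :=
  congrFun (pd_clm (EuclideanSpace.proj j : Plane →L[ℝ] ℝ) hg i) x

lemma integral_inner_fderiv_eq_zero (hh : IsH1 h) (hw : IsH1 w)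
    (hsymm : ∀ i j x, pd i h x j = pd j h x i) (hdiv : ∀ x, divergence w x = 0) (a : Plane) :
    ∫ x, inner ℝ (fderiv ℝ h x a) (w x) = 0 := by
  have hw' : ∀ j, IsH1 (fun x => w x j) := fun j => hw.clm (EuclideanSpace.proj j : Plane →L[ℝ] ℝ)
  have hh' : ∀ j, IsH1 (fun x => h x j) := fun j => hh.clm (EuclideanSpace.proj j : Plane →L[ℝ] ℝ)
  have e1 : ∀ x, inner ℝ (fderiv ℝ h x a) (w x) =
      ∑ i, a i * ∑ j, inner ℝ (w x j) (pd j (fun x => h x i) x) := by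
    intro x
    rw [fderiv_apply_eq_sum, sum_inner]
    refine Finset.sum_congr rfl fun i _ => ?_
    rw [inner_smul_left, inner_plane]
    simp only [hsymm i, pd_apply hh.contDiff]
    simp
  have hi : ∀ i j, Integrable (fun x => inner ℝ (w x j) (pd j (fun x => h x i) x)) := fun i j =>
    MemLp.integrable_inner (hw' j).memLp ((hh' i).memLp_pd j)
  have hi2 : ∀ i j, Integrable (fun x => inner ℝ (pd j (fun x => w x j) x) (h x i)) := fun i j =>
    MemLp.integrable_inner ((hw' j).memLp_pd j) (hh' i).memLp
  simp only [e1]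
  rw [integral_finsetSum _ fun i _ => (integrable_finsetSum _ fun j _ => hi i j).const_mul _]
  refine Finset.sum_eq_zero fun i _ => ?_
  rw [integral_const_mul, integral_finsetSum _ fun j _ => hi i j]
  simp only [fun j => (hw' j).integral_inner_pd (hh' i) j]
  rw [Finset.sum_neg_distrib, ← integral_finsetSum _ fun j _ => hi2 i j]
  simp only [← sum_inner, pd_apply hw.contDiff]
  have : ∀ x, ∑ j, pd j w x j = 0 := hdiv
  simp [this, -Fin.sum_univ_two]

lemma pd_translate {F : Type*} [NormedAddCommGroup F] [NormedSpace ℝ F] (g : Plane → F)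
    (a : Plane) (i : Fin 2) : pd i (fun x => g (x + a)) = fun x => pd i g (x + a) := by
  ext1 x; simp only [pd, fderiv_comp_add_right]

lemma memLp_translate {F : Type*} [NormedAddCommGroup F] {g : Plane → F}
    (hg : MemLp g 2 volume) (a : Plane) : MemLp (fun x => g (x + a)) 2 volume :=
  hg.comp_measurePreserving (measurePreserving_add_right volume a)

lemma IsH1.translate {F : Type*} [NormedAddCommGroup F] [NormedSpace ℝ F] {g : Plane → F}
    (hg : IsH1 g) (a : Plane) : IsH1 (fun x => g (x + a)) where
  contDiff := hg.contDiff.comp (contDiff_id.add contDiff_const)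
  memLp := memLp_translate hg.memLp a
  memLp_pd i := by rw [pd_translate]; exact memLp_translate (hg.memLp_pd i) a

lemma integral_inner_translate_eq (hh : IsH1 h) (hw : IsH1 w)
    (hsymm : ∀ i j x, pd i h x j = pd j h x i) (hdiv : ∀ x, divergence w x = 0) (a : Plane) :
    ∫ x, inner ℝ (h (x + a)) (w x) = ∫ x, inner ℝ (h x) (w x) := by
  have hfc : Continuous (fun x => fderiv ℝ h x a) :=
    (hh.contDiff.continuous_fderiv (by simp)).clm_apply continuous_const
  have hfm : MemLp (fun x => fderiv ℝ h x a) 2 volume := by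
    simp only [fderiv_apply_eq_sum]
    exact memLp_finsetSum _ fun i _ => (hh.memLp_pd i).const_smul (a i)
  set Φ : ℝ → Plane → ℝ := fun s x => inner ℝ (fderiv ℝ h (x + s • a) a) (w x) with hΦ
  have hΦc : Continuous (fun q : ℝ × Plane => Φ q.1 q.2) :=
    (hfc.comp (continuous_snd.add (continuous_fst.smul continuous_const))).inner
      (hw.contDiff.continuous.comp continuous_snd)
  have hslab : Integrable (fun q : ℝ × Plane => Φ q.1 q.2)
      ((volume.restrict (Ioc 0 1)).prod volume) := by
    refine integrable_slab (M := (∫ x, ‖fderiv ℝ h x a‖ ^ 2) + ∫ x, ‖w x‖ ^ 2)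
      hΦc.continuousOn (fun s _ => ?_) (fun s _ => ?_)
    · exact MemLp.integrable_inner (memLp_translate hfm (s • a)) hw.memLp
    · have i1 := MemLp.integrable_norm_sq (memLp_translate hfm (s • a))
      have i2 := MemLp.integrable_norm_sq hw.memLp
      have e : ∫ x, ‖fderiv ℝ h x a‖ ^ 2 = ∫ x, ‖fderiv ℝ h (x + s • a) a‖ ^ 2 :=
        (integral_add_right_eq_self (fun x => ‖fderiv ℝ h x a‖ ^ 2) (s • a)).symm
      rw [e, ← integral_add i1 i2]
      refine integral_mono_of_nonneg (Eventually.of_forall fun x => norm_nonneg _) (i1.add i2)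
        (Eventually.of_forall fun x => ?_)
      have := norm_inner_le_norm (𝕜 := ℝ) (fderiv ℝ h (x + s • a) a) (w x)
      simp only [hΦ]
      nlinarith [sq_nonneg (‖fderiv ℝ h (x + s • a) a‖ - ‖w x‖),
        norm_nonneg (fderiv ℝ h (x + s • a) a), norm_nonneg (w x)]
  have hftc : ∀ x, inner ℝ (h (x + a)) (w x) - inner ℝ (h x) (w x) = ∫ s in (0 : ℝ)..1, Φ s x := by
    intro x
    rw [intervalIntegral.integral_eq_sub_of_hasDerivAt
      (f := fun s : ℝ => inner ℝ (h (x + s • a)) (w x))]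
    · simp
    · intro s _
      have h1 : HasDerivAt (fun s : ℝ => x + s • a) a s := by
        simpa using ((hasDerivAt_id s).smul_const a).const_add x
      have h2 := (hh.contDiff.differentiable (by simp) (x + s • a)).hasFDerivAt.comp_hasDerivAt s h1
      simpa using h2.inner ℝ (hasDerivAt_const s (w x))
    · exact (hΦc.comp (continuous_id.prodMk continuous_const)).intervalIntegrable _ _
  have key := integral_eq_integral_slab zero_le_one hslab hftc
  have hz : ∀ s, ∫ x, Φ s x = 0 := by
    intro s
    have := integral_inner_fderiv_eq_zero (hh.translate (s • a)) hw
      (fun i j x => by simp only [pd_translate]; exact hsymm i j _) hdiv a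
    simpa only [fderiv_comp_add_right] using this
  simp only [hz, intervalIntegral.integral_zero] at key
  rw [integral_sub (MemLp.integrable_inner (memLp_translate hh.memLp a) hw.memLp)
    (MemLp.integrable_inner hh.memLp hw.memLp)] at key
  exact sub_eq_zero.1 key

lemma tendsto_integral_sq_tail {g : Plane → Plane} (hg : MemLp g 2 volume) :
    Tendsto (fun n : ℕ => ∫ x, ‖{x : Plane | (n : ℝ) ≤ ‖x‖}.indicator g x‖ ^ 2) atTop (𝓝 0) := by
  have hs : ∀ n : ℕ, MeasurableSet {x : Plane | (n : ℝ) ≤ ‖x‖} := fun n =>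
    (isClosed_le continuous_const continuous_norm).measurableSet
  rw [show (0 : ℝ) = ∫ _ : Plane, (0 : ℝ) by simp]
  refine tendsto_integral_of_dominated_convergence (fun x => ‖g x‖ ^ 2)
    (fun n => (hg.1.indicator (hs n)).norm.pow 2) (MemLp.integrable_norm_sq hg) (fun n => ?_) ?_
  · refine Eventually.of_forall fun x => ?_
    rw [Real.norm_of_nonneg (by positivity)]
    exact pow_le_pow_left₀ (norm_nonneg _) (norm_indicator_le_norm_self _ _) 2
  · refine Eventually.of_forall fun x => tendsto_const_nhds.congr' ?_
    obtain ⟨N, hN⟩ := exists_nat_gt ‖x‖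
    filter_upwards [eventually_ge_atTop N] with n hn
    have : x ∉ {x : Plane | (n : ℝ) ≤ ‖x‖} := by
      simp only [mem_ofPred_eq, not_le]
      exact hN.trans_le (by exact_mod_cast hn)
    simp [indicator_of_notMem this]

/-- Gradients are orthogonal to divergence-free fields. -/
lemma integral_inner_eq_zero_of_curl_free (hh : IsH1 h) (hw : IsH1 w)
    (hsymm : ∀ i j x, pd i h x j = pd j h x i) (hdiv : ∀ x, divergence w x = 0) :
    ∫ x, inner ℝ (h x) (w x) = 0 := by
  set c := ∫ x, inner ℝ (h x) (w x)
  set T : ℕ → Set Plane := fun n => {x : Plane | (n : ℝ) ≤ ‖x‖}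
  have hT : ∀ n : ℕ, MeasurableSet (T n) := fun n =>
    (isClosed_le continuous_const continuous_norm).measurableSet
  have hind : ∀ {g : Plane → Plane}, MemLp g 2 volume → ∀ n, MemLp ((T n).indicator g) 2 volume :=
    fun hg n => hg.indicator (hT n)
  have hbound : ∀ n : ℕ, c ^ 2 ≤ 2 * ((∫ x, ‖(T n).indicator h x‖ ^ 2) * (∫ x, ‖w x‖ ^ 2) +
      (∫ x, ‖h x‖ ^ 2) * ∫ x, ‖(T n).indicator w x‖ ^ 2) := by
    intro n
    set a : Plane := (2 * n : ℝ) • basisVec 0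
    have hna : ‖a‖ = 2 * n := by
      rw [norm_smul, norm_basisVec, mul_one, Real.norm_of_nonneg (by positivity)]
    have m1 := memLp_translate (hind hh.memLp n) a
    have m2 := memLp_translate hh.memLp a
    have p1 := sq_integral_norm_mul_norm_le m1 hw.memLp
    have p2 := sq_integral_norm_mul_norm_le m2 (hind hw.memLp n)
    rw [integral_add_right_eq_self (fun x => ‖(T n).indicator h x‖ ^ 2) a] at p1
    rw [integral_add_right_eq_self (fun x => ‖h x‖ ^ 2) a] at p2
    have hc : |c| ≤ (∫ x, ‖(T n).indicator h (x + a)‖ * ‖w x‖) +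
        ∫ x, ‖h (x + a)‖ * ‖(T n).indicator w x‖ := by
      rw [show c = ∫ x, inner ℝ (h (x + a)) (w x) from
        (integral_inner_translate_eq hh hw hsymm hdiv a).symm, ← integral_add
        (MemLp.integrable_norm_mul_norm m1 hw.memLp)
        (MemLp.integrable_norm_mul_norm m2 (hind hw.memLp n)), ← Real.norm_eq_abs]
      refine norm_integral_le_of_norm_le ((MemLp.integrable_norm_mul_norm m1 hw.memLp).add
        (MemLp.integrable_norm_mul_norm m2 (hind hw.memLp n))) (Eventually.of_forall fun x => ?_)
      refine (norm_inner_le_norm _ _).trans ?_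
      by_cases hx : x ∈ T n
      · rw [indicator_of_mem hx]
        exact le_add_of_nonneg_left (by positivity)
      · have hx' : ‖x‖ < n := not_le.1 hx
        have hxa : x + a ∈ T n := by
          have := norm_sub_le (x + a) x
          rw [add_sub_cancel_left, hna] at this
          simp only [T, mem_ofPred_eq]; linarith
        rw [indicator_of_mem hxa]
        exact le_add_of_nonneg_right (by positivity)
    have q : c ^ 2 ≤ _ := (sq_abs c).symm.trans_le (pow_le_pow_left₀ (abs_nonneg c) hc 2)
    nlinarith [sq_nonneg ((∫ x, ‖(T n).indicator h (x + a)‖ * ‖w x‖) -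
        ∫ x, ‖h (x + a)‖ * ‖(T n).indicator w x‖)]
  have hlim := (((tendsto_integral_sq_tail hh.memLp).mul_const (∫ x, ‖w x‖ ^ 2)).add
    ((tendsto_integral_sq_tail hw.memLp).const_mul (∫ x, ‖h x‖ ^ 2))).const_mul 2
  simp only [zero_mul, mul_zero, add_zero] at hlim
  have := ge_of_tendsto' hlim hbound
  nlinarith [sq_nonneg c]

lemma pd_gradient_symm {P : Plane → ℝ} (hP : Differentiable ℝ P)
    (hg : ContDiff ℝ ∞ (gradient P)) (i j : Fin 2) (x : Plane) :
    pd i (gradient P) x j = pd j (gradient P) x i := by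
  set L := (InnerProductSpace.toDual ℝ Plane).toContinuousLinearEquiv.toContinuousLinearMap
  have h1 : ∀ y, HasFDerivAt P (L (gradient P y)) y := fun y => (hP y).hasGradientAt.hasFDerivAt
  have h2 : HasFDerivAt (fun y => L (gradient P y)) (L.comp (fderiv ℝ (gradient P) x)) x :=
    L.hasFDerivAt.comp x (hg.differentiable (by simp) x).hasFDerivAt
  have h3 := second_derivative_symmetric h1 h2 (basisVec i) (basisVec j)
  have e : ∀ (y : Plane) (k : Fin 2), L y (basisVec k) = y k := by
    intro y k
    change inner ℝ y (basisVec k) = y k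
    simp [basisVec, EuclideanSpace.inner_single_right]
  simpa only [ContinuousLinearMap.comp_apply, e] using! h3

lemma divergence_pd {g : Plane → Plane} (hg : ContDiff ℝ ∞ g) (hdiv : ∀ x, divergence g x = 0)
    (i : Fin 2) (x : Plane) : divergence (pd i g) x = 0 := by
  have h1 : pd i (fun x => ∑ j, pd j g x j) x = 0 := by
    have : (fun x => ∑ j, pd j g x j) = fun _ => 0 := funext hdiv
    rw [this]; simp [pd]
  have h2 : HasFDerivAt (fun x => ∑ j, pd j g x j)
      (∑ j, (EuclideanSpace.proj j : Plane →L[ℝ] ℝ).comp (fderiv ℝ (pd j g) x)) x :=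
    HasFDerivAt.fun_sum fun j _ => (EuclideanSpace.proj j : Plane →L[ℝ] ℝ).hasFDerivAt.comp x
      ((contDiff_pd hg j).differentiable (by simp) x).hasFDerivAt
  rw [pd, h2.fderiv] at h1
  simp only [sum_apply, ContinuousLinearMap.comp_apply] at h1
  refine Eq.trans (Finset.sum_congr rfl fun j _ => ?_) h1
  exact congrArg (fun y : Plane => y j) (congrFun (pd_comm hg j i) x)

end Pressure

section SlabBounds

variable {a b : ℝ}

lemma integrable_slab_of_bound {Φ B : ℝ → Plane → ℝ} {m : ℝ → ℝ}
    (hc : ContinuousOn (fun q : ℝ × Plane => Φ q.1 q.2) (Icc a b ×ˢ univ))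
    (hB : ∀ t ∈ Icc a b, Integrable (B t)) (hΦ : ∀ t ∈ Icc a b, ∀ x, ‖Φ t x‖ ≤ B t x)
    (hm : ContinuousOn m (Icc a b)) (hBm : ∀ t ∈ Icc a b, ∫ x, B t x ≤ m t) :
    Integrable (fun q : ℝ × Plane => Φ q.1 q.2) ((volume.restrict (Ioc a b)).prod volume) := by
  obtain ⟨M, hM⟩ := (isCompact_Icc.image_of_continuousOn hm).bddAbove
  refine integrable_slab (M := M) hc (fun t ht => ?_) (fun t ht => ?_)
  · refine (hB t ht).mono' ?_ (Eventually.of_forall (hΦ t ht))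
    have : Continuous (fun x => Φ t x) := by
      rw [← continuousOn_univ]
      exact hc.comp (continuous_const.prodMk continuous_id).continuousOn
        (fun x _ => ⟨ht, mem_univ _⟩)
    exact this.aestronglyMeasurable
  · refine (integral_mono_of_nonneg (Eventually.of_forall fun x => norm_nonneg _) (hB t ht)
      (Eventually.of_forall (hΦ t ht))).trans ((hBm t ht).trans ?_)
    exact hM (mem_image_of_mem m ht)

lemma Icc_prod_subset_halfSpace (ha : 0 ≤ a) :
    Icc a b ×ˢ (univ : Set Plane) ⊆ Ici (0 : ℝ) ×ˢ univ :=
  prod_mono (fun _ ht => ha.trans ht.1) Subset.rfl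

lemma norm_mul_norm_le_add_sq {F G : Type*} [NormedAddCommGroup F] [NormedAddCommGroup G]
    (y : F) (z : G) :
    ‖y‖ * ‖z‖ ≤ ‖y‖ ^ 2 + ‖z‖ ^ 2 := by
  nlinarith [sq_nonneg (‖y‖ - ‖z‖), norm_nonneg y, norm_nonneg z]

variable {E : Type*} [NormedAddCommGroup E] [InnerProductSpace ℝ E] {p q : ℝ → Plane → E}

lemma L2Field.integrable_slab_norm_mul (hp : L2Field p) (hq : L2Field q) (ha : 0 ≤ a) :
    Integrable (fun z : ℝ × Plane => ‖p z.1 z.2‖ * ‖q z.1 z.2‖)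
      ((volume.restrict (Ioc a b)).prod volume) := by
  refine integrable_slab_of_bound (Φ := fun t x => ‖p t x‖ * ‖q t x‖)
    (B := fun t x => ‖p t x‖ ^ 2 + ‖q t x‖ ^ 2)
    (m := fun t => (∫ x, ‖p t x‖ ^ 2) + ∫ x, ‖q t x‖ ^ 2) ?_ (fun t ht => ?_) (fun t ht x => ?_) ?_
    (fun t ht => ?_)
  · exact (hp.continuousOn.norm.mul hq.continuousOn.norm).mono (Icc_prod_subset_halfSpace ha)
  · exact (MemLp.integrable_norm_sq (hp.memLp (ha.trans ht.1))).add
      (MemLp.integrable_norm_sq (hq.memLp (ha.trans ht.1)))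
  · rw [Real.norm_of_nonneg (by positivity)]
    exact norm_mul_norm_le_add_sq _ _
  · exact (hp.continuousOn_integral_sq.add hq.continuousOn_integral_sq).mono
      fun t ht => ha.trans ht.1
  · exact (integral_add (MemLp.integrable_norm_sq (hp.memLp (ha.trans ht.1)))
      (MemLp.integrable_norm_sq (hq.memLp (ha.trans ht.1)))).le

lemma L2Field.integrable_slab_inner (hp : L2Field p) (hq : L2Field q) (ha : 0 ≤ a) :
    Integrable (fun z : ℝ × Plane => inner ℝ (p z.1 z.2) (q z.1 z.2))
      ((volume.restrict (Ioc a b)).prod volume) :=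
  (hp.integrable_slab_norm_mul hq ha).mono'
    (aestronglyMeasurable_slab (Φ := fun t x => inner ℝ (p t x) (q t x))
      ((hp.continuousOn.inner hq.continuousOn).mono (Icc_prod_subset_halfSpace ha)))
    (Eventually.of_forall fun _ => norm_inner_le_norm _ _)

/-- `d/dt ‖w‖² = 2 ⟨w, ∂ₜw⟩` in integrated form. -/
lemma SmoothSobolev.integral_sq_sub {w : ℝ → Plane → E} (hw : SmoothSobolev w) (ha : 0 ≤ a)
    (hab : a ≤ b) :
    (∫ x, ‖w b x‖ ^ 2) - ∫ x, ‖w a x‖ ^ 2 =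
      ∫ t in a..b, 2 * ∫ x, inner ℝ (w t x) (_root_.timeDeriv w t x) := by
  have hslab := (hw.l2Field.integrable_slab_inner hw.timeDeriv.l2Field ha (b := b)).const_mul 2
  rw [← integral_sub (MemLp.integrable_norm_sq (hw.memLp_two (ha.trans hab)))
    (MemLp.integrable_norm_sq (hw.memLp_two ha))]
  simp only [← integral_const_mul]
  refine integral_eq_integral_slab hab
    (Φ := fun t x => 2 * inner ℝ (w t x) (_root_.timeDeriv w t x)) hslab fun x => ?_
  rw [intervalIntegral.integral_eq_sub_of_hasDerivAt_of_le hab (f := fun t => ‖w t x‖ ^ 2)]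
  · exact ((hw.smooth.continuousOn_time x).norm.pow 2).mono fun t ht => ha.trans ht.1
  · intro t ht
    exact (hw.smooth.hasDerivAt (ha.trans_lt ht.1) x).norm_sq
  · refine ContinuousOn.intervalIntegrable_of_Icc hab ?_
    exact (continuousOn_const.mul ((hw.smooth.continuousOn_time x).inner
      (hw.smooth.timeDeriv.continuousOn_time x))).mono fun t ht => ha.trans ht.1

end SlabBounds

section Transport

lemma integral_mul_fderiv_transport {φ q : Plane → ℝ} {u : Plane → Plane} (hφ : ContDiff ℝ ∞ φ)
    (hφc : HasCompactSupport φ) (hq : ContDiff ℝ ∞ q) (hu : ContDiff ℝ ∞ u)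
    (hdiv : ∀ x, divergence u x = 0) :
    ∫ x, φ x * fderiv ℝ q x (u x) = - ∫ x, q x * fderiv ℝ φ x (u x) := by
  have hui : ∀ i, ContDiff ℝ ∞ (fun x => u x i) := fun i =>
    (EuclideanSpace.proj i : Plane →L[ℝ] ℝ).contDiff.comp hu
  have hpi : ∀ i x, pd i (fun x => φ x * u x i) x = φ x * pd i u x i + u x i * pd i φ x := by
    intro i x
    have := ((hφ.differentiable (by simp) x).hasFDerivAt.mul
      ((hui i).differentiable (by simp) x).hasFDerivAt).fderiv
    have h2 := congrArg (fun A => A (basisVec i)) this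
    rw [← pd_apply hu]
    simpa using! h2
  have hcs : ∀ i, HasCompactSupport (fun x => φ x * u x i) := fun i => hφc.mul_right
  have hcd : ∀ i, ContDiff ℝ ∞ (fun x => φ x * u x i) := fun i => hφ.mul (hui i)
  have i1 : ∀ i, Integrable (fun x => pd i (fun x => φ x * u x i) x * q x) := fun i =>
    ((contDiff_pd (hcd i) i).continuous.mul hq.continuous).integrable_of_hasCompactSupport
      (HasCompactSupport.mul_right ((hcs i).fderiv_apply (𝕜 := ℝ) (basisVec i)))
  have i2 : ∀ i, Integrable (fun x => (φ x * u x i) * pd i q x) := fun i =>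
    ((hcd i).continuous.mul (contDiff_pd hq i).continuous).integrable_of_hasCompactSupport
      (hcs i).mul_right
  have ibp : ∀ i, ∫ x, (φ x * u x i) * pd i q x = - ∫ x, pd i (fun x => φ x * u x i) x * q x :=
    fun i => integral_mul_fderiv_eq_neg_fderiv_mul_of_integrable (v := basisVec i) (i1 i) (i2 i)
      (((hcd i).continuous.mul hq.continuous).integrable_of_hasCompactSupport (hcs i).mul_right)
      (fun x _ => (hcd i).differentiable (by simp) x) (fun x _ => hq.differentiable (by simp) x)
  calc ∫ x, φ x * fderiv ℝ q x (u x) = ∫ x, ∑ i, (φ x * u x i) * pd i q x := by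
        refine integral_congr_ae (Eventually.of_forall fun x => ?_)
        simp only [fderiv_apply_eq_sum, Finset.mul_sum, smul_eq_mul, mul_assoc]
    _ = - ∫ x, ∑ i, pd i (fun x => φ x * u x i) x * q x := by
        rw [integral_finsetSum _ fun i _ => i2 i, integral_finsetSum _ fun i _ => i1 i]
        simp only [ibp, Finset.sum_neg_distrib]
    _ = _ := by
        congr 1
        refine integral_congr_ae (Eventually.of_forall fun x => ?_)
        have hd : ∑ i, pd i u x i = 0 := hdiv x
        simp only [hpi, fderiv_apply_eq_sum, ← Finset.sum_mul, Finset.sum_add_distrib,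
          ← Finset.mul_sum, hd, smul_eq_mul]
        ring

end Transport

section Energy

lemma integrable_slab_of_compact_support {Φ : ℝ → Plane → ℝ} {a b : ℝ} {K : Set Plane}
    (hK : IsCompact K) (hc : ContinuousOn (fun q : ℝ × Plane => Φ q.1 q.2) (Icc a b ×ˢ univ))
    (h0 : ∀ t, ∀ x ∉ K, Φ t x = 0) :
    Integrable (fun q : ℝ × Plane => Φ q.1 q.2) ((volume.restrict (Ioc a b)).prod volume) := by
  have h1 : (volume.restrict (Ioc a b)).prod (volume : Measure Plane) =
      ((volume : Measure ℝ).prod (volume : Measure Plane)).restrict (Ioc a b ×ˢ univ) := by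
    rw [← Measure.prod_restrict, Measure.restrict_univ]
  rw [h1]
  have h2 : IntegrableOn (fun q : ℝ × Plane => Φ q.1 q.2) (Icc a b ×ˢ K)
      ((volume : Measure ℝ).prod (volume : Measure Plane)) :=
    (hc.mono (prod_mono Subset.rfl (subset_univ _))).integrableOn_compact (isCompact_Icc.prod hK)
  refine h2.of_forall_sdiff_eq_zero (measurableSet_Ioc.prod MeasurableSet.univ) ?_
  rintro ⟨t, x⟩ ⟨⟨ht, _⟩, hx⟩
  exact h0 t x fun hxK => hx ⟨Ioc_subset_Icc_self ht, hxK⟩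

variable {ρ : ℝ → Plane → ℝ} {u : ℝ → Plane → Plane} {P : ℝ → Plane → ℝ}
  {v : ℝ → Plane → Plane} {Pv : ℝ → Plane → ℝ} {f : ℝ → Plane → Plane} {a b : ℝ}

/-- The field `f + Δv - ∇Π_v`, the momentum balance of `ρ (∂ₜv + u·∇v)`. -/
def momentumRHS (v : ℝ → Plane → Plane) (Pv : ℝ → Plane → ℝ) (f : ℝ → Plane → Plane) (t : ℝ)
    (x : Plane) : Plane :=
  f t x + (pd 0 (pd 0 (v t)) x + pd 1 (pd 1 (v t)) x) + - gradient (Pv t) x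

lemma IsSolLINS2D.l2Field_momentumRHS (h : IsSolLINS2D ρ u P v Pv f) :
    L2Field (momentumRHS v Pv f) :=
  (h.sobolev_f.l2Field.add ((((h.sobolev_v.pd 0).pd 0).l2Field).add
    ((h.sobolev_v.pd 1).pd 1).l2Field)).add h.sobolev_gradPv.l2Field.neg

lemma IsSolLINS2D.momentumRHS_eq (h : IsSolLINS2D ρ u P v Pv f) {t : ℝ} (ht : 0 ≤ t) (x : Plane) :
    ρ t x • timeDeriv v t x + ρ t x • fderiv ℝ (v t) x (u t x) = momentumRHS v Pv f t x := by
  have := h.momentum t ht x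
  rw [laplacian_eq_sum_pd (h.sobolev_v.contDiff ht), Fin.sum_univ_two] at this
  rw [momentumRHS, ← this]; abel

lemma IsSolLINS2D.rho_nonneg (h : IsSolLINS2D ρ u P v Pv f) {t : ℝ} (ht : 0 ≤ t) (x : Plane) :
    0 ≤ ρ t x := by linarith [h.rho_lower t ht x]

lemma IsSolLINS2D.integrable_rho_sq (h : IsSolLINS2D ρ u P v Pv f) {t : ℝ} (ht : 0 ≤ t)
    {g : Plane → Plane} (hg : MemLp g 2 volume) : Integrable (fun x => ρ t x * ‖g x‖ ^ 2) := by
  refine ((MemLp.integrable_norm_sq hg).const_mul 2).mono'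
    ((h.base.smooth_rho.contDiff ht).continuous.aestronglyMeasurable.mul (hg.1.norm.pow 2))
    (Eventually.of_forall fun x => ?_)
  rw [Real.norm_of_nonneg (mul_nonneg (h.rho_nonneg ht x) (by positivity))]
  exact mul_le_mul_of_nonneg_right (h.rho_upper t ht x) (by positivity)

/-- The energy balance against a cutoff. -/
lemma IsSolLINS2D.cutoff_energy (h : IsSolLINS2D ρ u P v Pv f) (ha : 0 ≤ a) (hab : a ≤ b) (n : ℕ) :
    (∫ x, cutoff n x * (ρ b x * ‖v b x‖ ^ 2 - ρ a x * ‖v a x‖ ^ 2)) =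
      ∫ t in a..b, ∫ x, (ρ t x * ‖v t x‖ ^ 2 * fderiv ℝ (cutoff n) x (u t x) +
        cutoff n x * (2 * inner ℝ (v t x) (momentumRHS v Pv f t x))) := by
  have hρ := h.base.smooth_rho
  have hv := h.sobolev_v.smooth
  have hsub : Icc a b ⊆ Ici 0 := fun t ht => ha.trans ht.1
  set Φ : ℝ → Plane → ℝ := fun t x => cutoff n x * (timeDeriv ρ t x * ‖v t x‖ ^ 2 +
    ρ t x * (2 * inner ℝ (v t x) (timeDeriv v t x))) with hΦ
  have hΦc : ContinuousOn (fun q : ℝ × Plane => Φ q.1 q.2) (Icc a b ×ˢ univ) := by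
    refine ContinuousOn.mono ?_ (Icc_prod_subset_halfSpace ha)
    have c1 := ContDiffOn.continuousOn hρ
    have c2 := ContDiffOn.continuousOn hv
    have c3 := ContDiffOn.continuousOn hρ.timeDeriv
    have c4 := ContDiffOn.continuousOn hv.timeDeriv
    exact ((contDiff_cutoff n).continuous.comp continuous_snd).continuousOn.mul
      ((c3.mul (c2.norm.pow 2)).add (c1.mul (continuousOn_const.mul (c2.inner c4))))
  have hslab := integrable_slab_of_compact_support (hasCompactSupport_cutoff n) hΦc
    (fun t x hx => by simp only [hΦ, image_eq_zero_of_notMem_tsupport hx, zero_mul])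
  rw [integral_eq_integral_slab hab hslab]
  · refine intervalIntegral.integral_congr fun t ht => ?_
    rw [uIcc_of_le hab] at ht
    have ht0 : 0 ≤ t := hsub ht
    have hq : ContDiff ℝ ∞ (fun x => ρ t x * ‖v t x‖ ^ 2) :=
      (hρ.contDiff ht0).mul ((hv.contDiff ht0).norm_sq ℝ)
    have hut := h.base.sobolev_u.contDiff ht0
    have hcut := hasCompactSupport_cutoff n
    have hm := h.l2Field_momentumRHS
    have hΦe : ∀ x, Φ t x = - (cutoff n x * fderiv ℝ (fun x => ρ t x * ‖v t x‖ ^ 2) x (u t x)) +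
        cutoff n x * (2 * inner ℝ (v t x) (momentumRHS v Pv f t x)) := by
      intro x
      have hd := (((hρ.contDiff ht0).differentiable (by simp) x).hasFDerivAt.mul
        (((hv.contDiff ht0).differentiable (by simp) x).hasFDerivAt.norm_sq)).fderiv
      have hd2 : fderiv ℝ (fun x => ρ t x * ‖v t x‖ ^ 2) x (u t x) =
          ρ t x * (2 * inner ℝ (v t x) (fderiv ℝ (v t) x (u t x))) +
            ‖v t x‖ ^ 2 * fderiv ℝ (ρ t) x (u t x) := by
        refine (congrArg (fun A => A (u t x)) hd).trans ?_
        simp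
      have hmass := h.base.mass t ht0 x
      rw [hd2, ← h.momentumRHS_eq ht0, inner_add_right, inner_smul_right, inner_smul_right]
      simp only [hΦ]
      rw [eq_neg_of_add_eq_zero_left hmass]
      ring
    have htr := integral_mul_fderiv_transport (contDiff_cutoff n) hcut hq hut
      (h.base.incompressible t ht0)
    have j1 : Integrable (fun x => cutoff n x *
        fderiv ℝ (fun x => ρ t x * ‖v t x‖ ^ 2) x (u t x)) :=
      ((contDiff_cutoff n).continuous.mul ((hq.continuous_fderiv (by simp)).clm_apply
        hut.continuous)).integrable_of_hasCompactSupport hcut.mul_right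
    have j2 : Integrable (fun x => cutoff n x *
        (2 * inner ℝ (v t x) (momentumRHS v Pv f t x))) := by
      refine Integrable.bdd_mul (c := 1)
        ((MemLp.integrable_inner (h.sobolev_v.memLp_two ht0) (hm.memLp ht0)).const_mul 2)
        (contDiff_cutoff n).continuous.aestronglyMeasurable (Eventually.of_forall fun x => ?_)
      rw [Real.norm_of_nonneg (cutoff_nonneg n x)]; exact cutoff_le_one n x
    have j3 : Integrable (fun x => ρ t x * ‖v t x‖ ^ 2 * fderiv ℝ (cutoff n) x (u t x)) := by
      refine (hq.continuous.mul (((contDiff_cutoff n).continuous_fderiv (by simp)).clm_apply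
        hut.continuous)).integrable_of_hasCompactSupport (HasCompactSupport.mul_left ?_)
      refine (hcut.fderiv (𝕜 := ℝ)).mono fun x hx => ?_
      rw [Function.mem_support] at hx ⊢
      intro h0
      exact hx (by rw [h0]; rfl)
    simp only [hΦe]
    have j1n : Integrable (fun x => - (cutoff n x *
        fderiv ℝ (fun x => ρ t x * ‖v t x‖ ^ 2) x (u t x))) := j1.neg
    rw [integral_add j1n j2, integral_neg, htr, neg_neg, ← integral_add j3 j2]
  · intro x
    rw [intervalIntegral.integral_eq_sub_of_hasDerivAt_of_le hab
      (f := fun t => cutoff n x * (ρ t x * ‖v t x‖ ^ 2))]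
    · ring
    · exact (continuousOn_const.mul ((hρ.continuousOn_time x).mul
        ((hv.continuousOn_time x).norm.pow 2))).mono hsub
    · intro t ht
      have ht0 : 0 < t := ha.trans_lt ht.1
      exact ((hρ.hasDerivAt ht0 x).mul ((hv.hasDerivAt ht0 x).norm_sq)).const_mul (cutoff n x)
    · refine ContinuousOn.intervalIntegrable_of_Icc hab ?_
      exact ContinuousOn.comp (g := fun q : ℝ × Plane => Φ q.1 q.2) (f := fun t => (t, x)) hΦc
        (continuous_id.prodMk continuous_const).continuousOn (fun t ht => ⟨ht, mem_univ _⟩)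

end Energy

section EnergyBalance

variable {ρ : ℝ → Plane → ℝ} {u : ℝ → Plane → Plane} {P : ℝ → Plane → ℝ}
  {v : ℝ → Plane → Plane} {Pv : ℝ → Plane → ℝ} {f : ℝ → Plane → Plane} {a b : ℝ}

lemma IsSolLINS2D.integrable_slab_sq_mul_norm (h : IsSolLINS2D ρ u P v Pv f) (ha : 0 ≤ a) :
    Integrable (fun z : ℝ × Plane => ‖v z.1 z.2‖ ^ 2 * ‖u z.1 z.2‖)
      ((volume.restrict (Ioc a b)).prod volume) := by
  have hv := h.sobolev_v
  have hu := h.base.sobolev_u.l2Field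
  have hsub : Icc a b ⊆ Ici 0 := fun t ht => ha.trans ht.1
  have hi : ∀ t ∈ Icc a b, Integrable (fun x => ‖v t x‖ ^ 4) := fun t ht => by
    have := MemLp.integrable_norm_sq (hv.isH1 (hsub ht)).ladyzhenskaya.1
    simpa only [norm_pow, norm_norm, ← pow_mul] using this
  refine integrable_slab_of_bound (Φ := fun t x => ‖v t x‖ ^ 2 * ‖u t x‖)
    (B := fun t x => ‖v t x‖ ^ 4 + ‖u t x‖ ^ 2)
    (m := fun t => ladyConst * (∫ x, ‖v t x‖ ^ 2) * (∑ i, ∫ x, ‖pd i (v t) x‖ ^ 2) +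
      ∫ x, ‖u t x‖ ^ 2) ?_ (fun t ht => ?_) (fun t ht x => ?_) ?_ (fun t ht => ?_)
  · exact ((hv.l2Field.continuousOn.norm.pow 2).mul hu.continuousOn.norm).mono
      (Icc_prod_subset_halfSpace ha)
  · exact (hi t ht).add (MemLp.integrable_norm_sq (hu.memLp (hsub ht)))
  · rw [Real.norm_of_nonneg (by positivity)]
    nlinarith [sq_nonneg (‖v t x‖ ^ 2 - ‖u t x‖), sq_nonneg (‖v t x‖ ^ 2), sq_nonneg ‖u t x‖]
  · refine ContinuousOn.mono ?_ hsub
    exact ((continuousOn_const.mul hv.l2Field.continuousOn_integral_sq).mul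
      (continuousOn_finsetSum _ fun i _ => (hv.pd i).l2Field.continuousOn_integral_sq)).add
      hu.continuousOn_integral_sq
  · rw [integral_add (hi t ht) (MemLp.integrable_norm_sq (hu.memLp (hsub ht)))]
    exact add_le_add_left (hv.isH1 (hsub ht)).ladyzhenskaya.2 _

lemma IsSolLINS2D.energy_eq (h : IsSolLINS2D ρ u P v Pv f) (ha : 0 ≤ a) (hab : a ≤ b) :
    (∫ x, ρ b x * ‖v b x‖ ^ 2) - ∫ x, ρ a x * ‖v a x‖ ^ 2 =
      ∫ t in a..b, 2 * ∫ x, inner ℝ (v t x) (momentumRHS v Pv f t x) := by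
  have hv := h.sobolev_v
  have hm := h.l2Field_momentumRHS
  have hsub : Icc a b ⊆ Ici 0 := fun t ht => ha.trans ht.1
  obtain ⟨M, hM0, hM⟩ := exists_fderiv_cutoff_le
  have hM' : ∀ n x, ‖fderiv ℝ (cutoff n) x‖ ≤ M := fun n x => (hM n x).trans
    (mul_le_of_le_one_right hM0 (inv_le_one_of_one_le₀ (by linarith [n.cast_nonneg (α := ℝ)])))
  set μ := (volume.restrict (Ioc a b)).prod (volume : Measure Plane)
  set Ψ : ℕ → ℝ → Plane → ℝ := fun n t x => ρ t x * ‖v t x‖ ^ 2 * fderiv ℝ (cutoff n) x (u t x) +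
        cutoff n x * (2 * inner ℝ (v t x) (momentumRHS v Pv f t x)) with hΨ
  set B : ℝ × Plane → ℝ := fun z => 2 * M * (‖v z.1 z.2‖ ^ 2 * ‖u z.1 z.2‖) +
    2 * (‖v z.1 z.2‖ * ‖momentumRHS v Pv f z.1 z.2‖) with hB
  have hBi : Integrable B μ := ((h.integrable_slab_sq_mul_norm ha).const_mul _).add
    ((hv.l2Field.integrable_slab_norm_mul hm ha).const_mul 2)
  have hΨm : ∀ n, AEStronglyMeasurable (fun z : ℝ × Plane => Ψ n z.1 z.2) μ := by
    intro n
    refine aestronglyMeasurable_slab (ContinuousOn.mono ?_ (Icc_prod_subset_halfSpace ha))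
    have c1 := ContDiffOn.continuousOn h.base.smooth_rho
    have c2 := hv.l2Field.continuousOn
    have c3 := h.base.sobolev_u.l2Field.continuousOn
    have c4 : Continuous (fun z : ℝ × Plane => fderiv ℝ (cutoff n) z.2) :=
      ((contDiff_cutoff n).continuous_fderiv (by simp)).comp continuous_snd
    exact ((c1.mul (c2.norm.pow 2)).mul (c4.continuousOn.clm_apply c3)).add
      (((contDiff_cutoff n).continuous.comp continuous_snd).continuousOn.mul
        (continuousOn_const.mul (c2.inner hm.continuousOn)))
  have hmem : ∀ᵐ z ∂μ, z.1 ∈ Icc a b := by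
    have h1 : μ = ((volume : Measure ℝ).prod (volume : Measure Plane)).restrict
        (Ioc a b ×ˢ univ) := by
      rw [← Measure.prod_restrict, Measure.restrict_univ]
    rw [h1]
    filter_upwards [ae_restrict_mem (measurableSet_Ioc.prod MeasurableSet.univ)] with z hz
    exact Ioc_subset_Icc_self hz.1
  have hΨB : ∀ n, ∀ᵐ z ∂μ, ‖Ψ n z.1 z.2‖ ≤ B z := by
    intro n
    filter_upwards [hmem] with z hz
    have hr0 := h.rho_nonneg (hsub hz) z.2
    have hr := h.rho_upper z.1 (hsub hz) z.2
    refine (norm_add_le _ _).trans (add_le_add ?_ ?_)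
    · rw [norm_mul, norm_mul, Real.norm_of_nonneg hr0, norm_pow, norm_norm]
      have hf := ((fderiv ℝ (cutoff n) z.2).le_opNorm (u z.1 z.2)).trans
        (mul_le_mul_of_nonneg_right (hM' n z.2) (norm_nonneg _))
      calc _ ≤ 2 * ‖v z.1 z.2‖ ^ 2 * (M * ‖u z.1 z.2‖) :=
            mul_le_mul (mul_le_mul_of_nonneg_right hr (by positivity)) hf (norm_nonneg _)
              (by positivity)
        _ = _ := by ring
    · rw [norm_mul, Real.norm_of_nonneg (cutoff_nonneg n _), norm_mul, Real.norm_ofNat]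
      refine (mul_le_of_le_one_left (by positivity) (cutoff_le_one n _)).trans ?_
      exact mul_le_mul_of_nonneg_left (norm_inner_le_norm _ _) zero_le_two
  have hlim1 : Tendsto (fun n => ∫ z, Ψ n z.1 z.2 ∂μ) atTop
      (𝓝 (∫ z, 2 * inner ℝ (v z.1 z.2) (momentumRHS v Pv f z.1 z.2) ∂μ)) := by
    refine tendsto_integral_of_dominated_convergence B hΨm hBi hΨB
      (Eventually.of_forall fun z => ?_)
    have t1 : Tendsto (fun n => fderiv ℝ (cutoff n) z.2) atTop (𝓝 0) := by
      refine squeeze_zero_norm (fun n => hM n z.2) ?_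
      simpa using (tendsto_one_div_add_atTop_nhds_zero_nat (𝕜 := ℝ)).const_mul M
    have t2 : Tendsto (fun n => fderiv ℝ (cutoff n) z.2 (u z.1 z.2)) atTop (𝓝 0) := by
      simpa using! ((ContinuousLinearMap.apply ℝ ℝ (u z.1 z.2)).continuous.tendsto 0).comp t1
    simpa using (t2.const_mul (ρ z.1 z.2 * ‖v z.1 z.2‖ ^ 2)).add
      ((tendsto_cutoff z.2).mul_const (2 * inner ℝ (v z.1 z.2) (momentumRHS v Pv f z.1 z.2)))
  have hEb := h.integrable_rho_sq (ha.trans hab) (hv.memLp_two (ha.trans hab))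
  have hEa := h.integrable_rho_sq ha (hv.memLp_two ha)
  have hlim2 : Tendsto (fun n => ∫ x, cutoff n x * (ρ b x * ‖v b x‖ ^ 2 - ρ a x * ‖v a x‖ ^ 2))
      atTop (𝓝 (∫ x, (ρ b x * ‖v b x‖ ^ 2 - ρ a x * ‖v a x‖ ^ 2))) := by
    refine tendsto_integral_of_dominated_convergence
      (fun x => ‖ρ b x * ‖v b x‖ ^ 2 - ρ a x * ‖v a x‖ ^ 2‖)
      (fun n => (contDiff_cutoff n).continuous.aestronglyMeasurable.mul (hEb.sub hEa).1)
      (hEb.sub hEa).norm (fun n => Eventually.of_forall fun x => ?_)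
      (Eventually.of_forall fun x => ?_)
    · rw [norm_mul, Real.norm_of_nonneg (cutoff_nonneg n x)]
      exact mul_le_of_le_one_left (norm_nonneg _) (cutoff_le_one n x)
    · simpa using (tendsto_cutoff x).mul_const (ρ b x * ‖v b x‖ ^ 2 - ρ a x * ‖v a x‖ ^ 2)
  have heq : ∀ n, ∫ x, cutoff n x * (ρ b x * ‖v b x‖ ^ 2 - ρ a x * ‖v a x‖ ^ 2) =
      ∫ z, Ψ n z.1 z.2 ∂μ := fun n => by
    rw [h.cutoff_energy ha hab n, integral_slab hab (hBi.mono' (hΨm n) (hΨB n))]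
  have hfin := tendsto_nhds_unique (hlim2.congr heq) hlim1
  rw [integral_sub hEb hEa] at hfin
  rw [hfin, integral_slab (Φ := fun t x => 2 * inner ℝ (v t x) (momentumRHS v Pv f t x)) hab
    ((hv.l2Field.integrable_slab_inner hm ha).const_mul 2)]
  simp only [integral_const_mul]

end EnergyBalance

section Gronwall

variable {t₀ t₁ : ℝ}

lemma continuousOn_primitive_Icc {c : ℝ → ℝ} (h : t₀ ≤ t₁) (hc : ContinuousOn c (Icc t₀ t₁)) :
    ContinuousOn (fun t => ∫ s in t₀..t, c s) (Icc t₀ t₁) := by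
  have := intervalIntegral.continuousOn_primitive_interval' (μ := volume) (a := t₀)
    (hc.intervalIntegrable_of_Icc h) left_mem_uIcc
  rwa [uIcc_of_le h] at this

lemma hasDerivAt_primitive_Ioo {c : ℝ → ℝ} (hc : ContinuousOn c (Icc t₀ t₁)) {t : ℝ}
    (ht : t ∈ Ioo t₀ t₁) : HasDerivAt (fun t => ∫ s in t₀..t, c s) (c t) t := by
  have hi : IntervalIntegrable c volume t₀ t :=
    (hc.mono (Icc_subset_Icc_right ht.2.le)).intervalIntegrable_of_Icc ht.1.le
  have hn : Icc t₀ t₁ ∈ 𝓝 t := Icc_mem_nhds ht.1 ht.2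
  exact intervalIntegral.integral_hasDerivAt_right hi
    ((hc.mono Ioo_subset_Icc_self).stronglyMeasurableAtFilter isOpen_Ioo t ht)
    (hc.continuousAt hn)

/-- Grönwall's inequality with a weight `θ` and a dissipation term `D`. -/
lemma weighted_gronwall {A a D r m θ θ' : ℝ → ℝ} (h : t₀ ≤ t₁)
    (hA : ∀ t ∈ Icc t₀ t₁, A t - A t₀ = ∫ s in t₀..t, a s)
    (hac : ContinuousOn a (Icc t₀ t₁)) (hrc : ContinuousOn r (Icc t₀ t₁))
    (hmc : ContinuousOn m (Icc t₀ t₁)) (hD : IntervalIntegrable D volume t₀ t₁)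
    (hθc : ContinuousOn θ (Icc t₀ t₁)) (hθ'c : ContinuousOn θ' (Icc t₀ t₁))
    (hθ : ∀ t ∈ Ioo t₀ t₁, HasDerivAt θ (θ' t) t)
    (hA0 : ∀ t ∈ Icc t₀ t₁, 0 ≤ A t) (hr0 : ∀ t ∈ Icc t₀ t₁, 0 ≤ r t)
    (hm0 : ∀ t ∈ Icc t₀ t₁, 0 ≤ m t) (hD0 : ∀ t ∈ Icc t₀ t₁, 0 ≤ D t)
    (hθ0 : ∀ t ∈ Icc t₀ t₁, 0 ≤ θ t) (hθ'0 : ∀ t ∈ Icc t₀ t₁, 0 ≤ θ' t)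
    (hle : ∀ t ∈ Icc t₀ t₁, a t + D t ≤ r t + m t * A t) :
    θ t₁ * A t₁ + ∫ t in t₀..t₁, θ t * D t ≤
      (θ t₀ * A t₀ + (∫ t in t₀..t₁, θ' t * A t) + ∫ t in t₀..t₁, θ t * r t) *
        Real.exp (∫ t in t₀..t₁, m t) := by
  have hAe : ∀ t ∈ Icc t₀ t₁, A t = A t₀ + ∫ s in t₀..t, a s := fun t ht => by
    linarith [hA t ht]
  have hAc : ContinuousOn A (Icc t₀ t₁) :=
    (continuousOn_const.add (continuousOn_primitive_Icc h hac)).congr hAe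
  have hAd : ∀ t ∈ Ioo t₀ t₁, HasDerivAt A (a t) t := by
    intro t ht
    refine ((hasDerivAt_primitive_Ioo hac ht).const_add (A t₀)).congr_of_eventuallyEq ?_
    filter_upwards [Icc_mem_nhds ht.1 ht.2] with s hs using hAe s hs
  set M : ℝ → ℝ := fun t => ∫ s in t₀..t, m s with hM
  have hMc : ContinuousOn M (Icc t₀ t₁) := continuousOn_primitive_Icc h hmc
  have hMd : ∀ t ∈ Ioo t₀ t₁, HasDerivAt M (m t) t := fun t ht => hasDerivAt_primitive_Ioo hmc ht
  have hM0 : ∀ t ∈ Icc t₀ t₁, 0 ≤ M t := fun t ht =>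
    intervalIntegral.integral_nonneg ht.1 fun s hs => hm0 s ⟨hs.1, hs.2.trans ht.2⟩
  have hM1 : ∀ t ∈ Icc t₀ t₁, M t ≤ M t₁ := fun t ht => by
    have := intervalIntegral.integral_add_adjacent_intervals
      ((hmc.mono (Icc_subset_Icc_right ht.2)).intervalIntegrable_of_Icc ht.1 (μ := volume))
      ((hmc.mono (Icc_subset_Icc_left ht.1)).intervalIntegrable_of_Icc ht.2)
    have h2 : 0 ≤ ∫ s in t..t₁, m s :=
      intervalIntegral.integral_nonneg ht.2 fun s hs => hm0 s ⟨ht.1.trans hs.1, hs.2⟩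
    simp only [hM]; linarith
  set e : ℝ → ℝ := fun t => Real.exp (- M t) with he
  have hec : ContinuousOn e (Icc t₀ t₁) := hMc.neg.rexp
  have hed : ∀ t ∈ Ioo t₀ t₁, HasDerivAt e (- (m t) * e t) t := fun t ht => by
    have := (hMd t ht).neg.exp
    rwa [mul_comm] at this
  have hftc : ∫ t in t₀..t₁, (-(m t) * e t * (θ t * A t) + e t * (θ' t * A t + θ t * a t)) =
      e t₁ * (θ t₁ * A t₁) - e t₀ * (θ t₀ * A t₀) := by
    refine intervalIntegral.integral_eq_sub_of_hasDerivAt_of_le h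
      (f := fun t => e t * (θ t * A t)) (hec.mul (hθc.mul hAc)) (fun t ht => ?_) ?_
    · exact (hed t ht).mul ((hθ t ht).mul (hAd t ht))
    · exact ContinuousOn.intervalIntegrable_of_Icc h ((((hmc.neg).mul hec).mul (hθc.mul hAc)).add
        (hec.mul ((hθ'c.mul hAc).add (hθc.mul hac))))
  have hθD : IntervalIntegrable (fun t => θ t * D t) volume t₀ t₁ :=
    hD.continuousOn_mul (by rwa [uIcc_of_le h])
  have i1 : IntervalIntegrable (fun t => θ' t * A t) volume t₀ t₁ :=
    (hθ'c.mul hAc).intervalIntegrable_of_Icc h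
  have i2 : IntervalIntegrable (fun t => θ t * r t) volume t₀ t₁ :=
    (hθc.mul hrc).intervalIntegrable_of_Icc h
  have key : e t₁ * (∫ t in t₀..t₁, θ t * D t) +
      ∫ t in t₀..t₁, (-(m t) * e t * (θ t * A t) + e t * (θ' t * A t + θ t * a t)) ≤
      (∫ t in t₀..t₁, θ' t * A t) + ∫ t in t₀..t₁, θ t * r t := by
    have i3 : IntervalIntegrable
        (fun t => -(m t) * e t * (θ t * A t) + e t * (θ' t * A t + θ t * a t)) volume t₀ t₁ :=
      ContinuousOn.intervalIntegrable_of_Icc h ((((hmc.neg).mul hec).mul (hθc.mul hAc)).add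
        (hec.mul ((hθ'c.mul hAc).add (hθc.mul hac))))
    rw [← intervalIntegral.integral_const_mul, ← intervalIntegral.integral_add
      (hθD.const_mul _) i3, ← intervalIntegral.integral_add i1 i2]
    refine intervalIntegral.integral_mono_on h ((hθD.const_mul _).add i3) (i1.add i2) fun t ht => ?_
    have e0 : 0 < e t := Real.exp_pos _
    have e1 : e t ≤ 1 := Real.exp_le_one_iff.2 (neg_nonpos.2 (hM0 t ht))
    have e2 : e t₁ ≤ e t := Real.exp_le_exp.2 (neg_le_neg (hM1 t ht))
    have p1 : e t₁ * (θ t * D t) ≤ e t * (θ t * D t) :=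
      mul_le_mul_of_nonneg_right e2 (mul_nonneg (hθ0 t ht) (hD0 t ht))
    have p2 : e t * (θ t * (a t + D t)) ≤ e t * (θ t * (r t + m t * A t)) :=
      mul_le_mul_of_nonneg_left (mul_le_mul_of_nonneg_left (hle t ht) (hθ0 t ht)) e0.le
    have p3 : e t * (θ' t * A t + θ t * r t) ≤ 1 * (θ' t * A t + θ t * r t) :=
      mul_le_mul_of_nonneg_right e1 (add_nonneg (mul_nonneg (hθ'0 t ht) (hA0 t ht))
        (mul_nonneg (hθ0 t ht) (hr0 t ht)))
    linarith
  have he0 : e t₀ = 1 := by simp [he, hM]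
  rw [hftc, he0] at key
  have hexp : Real.exp (M t₁) * e t₁ = 1 := by rw [he, ← Real.exp_add]; simp
  have hpos := Real.exp_pos (M t₁)
  calc _ = Real.exp (M t₁) * e t₁ * (θ t₁ * A t₁ + ∫ t in t₀..t₁, θ t * D t) := by
        rw [hexp, one_mul]
    _ = Real.exp (M t₁) * (e t₁ * (θ t₁ * A t₁) + e t₁ * ∫ t in t₀..t₁, θ t * D t) := by ring
    _ ≤ Real.exp (M t₁) *
        (θ t₀ * A t₀ + (∫ t in t₀..t₁, θ' t * A t) + ∫ t in t₀..t₁, θ t * r t) :=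
      mul_le_mul_of_nonneg_left (by linarith) hpos.le
    _ = _ := by rw [mul_comm]

end Gronwall

section Momentum

variable {ρ : ℝ → Plane → ℝ} {u : ℝ → Plane → Plane} {P : ℝ → Plane → ℝ}
  {v : ℝ → Plane → Plane} {Pv : ℝ → Plane → ℝ} {f : ℝ → Plane → Plane} {t : ℝ}

lemma IsSolLINS2D.integral_gradient_eq_zero (h : IsSolLINS2D ρ u P v Pv f) (ht : 0 ≤ t)
    {w : Plane → Plane} (hw : IsH1 w) (hdiv : ∀ x, divergence w x = 0) :
    ∫ x, inner ℝ (gradient (Pv t) x) (w x) = 0 :=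
  integral_inner_eq_zero_of_curl_free (h.sobolev_gradPv.isH1 ht) hw
    (pd_gradient_symm (h.diff_Pv t ht) (h.sobolev_gradPv.contDiff ht)) hdiv

lemma divergence_timeDeriv (hv : SmoothField v) (hdiv : ∀ t, 0 ≤ t → ∀ x, divergence (v t) x = 0)
    (ht : 0 ≤ t) (x : Plane) : divergence (timeDeriv v t) x = 0 := by
  have h1 : HasDerivWithinAt (fun τ => ∑ i, pd i (v τ) x i)
      (∑ i, timeDeriv (fun t => pd i (v t)) t x i) (Ici 0) t :=
    HasDerivWithinAt.fun_sum fun i _ =>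
      (EuclideanSpace.proj i : Plane →L[ℝ] ℝ).hasFDerivAt.comp_hasDerivWithinAt t
        ((hv.pd i).hasDerivWithinAt ht x)
  have h2 : HasDerivWithinAt (fun τ => ∑ i, pd i (v τ) x i) 0 (Ici 0) t :=
    (hasDerivWithinAt_const t (Ici 0) 0).congr (fun τ hτ => hdiv τ hτ x) (hdiv t ht x)
  refine Eq.trans (Finset.sum_congr rfl fun i _ => ?_)
    ((uniqueDiffOn_Ici 0 t ht).eq_deriv _ h1 h2)
  rw [hv.timeDeriv_pd i ht]
  rfl

/-- The pairing of `v` with the momentum balance. -/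
lemma IsSolLINS2D.integral_inner_momentumRHS (h : IsSolLINS2D ρ u P v Pv f) (ht : 0 ≤ t) :
    ∫ x, inner ℝ (v t x) (momentumRHS v Pv f t x) =
      (∫ x, inner ℝ (v t x) (f t x)) - ∑ i, ∫ x, ‖pd i (v t) x‖ ^ 2 := by
  have hv := h.sobolev_v.isH1 ht
  have hp := h.integral_gradient_eq_zero ht hv (h.incompressible t ht)
  have hvi : ∀ i, IsH1 (pd i (v t)) := fun i => (h.sobolev_v.pd i).isH1 ht
  have j1 := MemLp.integrable_inner hv.memLp (h.sobolev_f.memLp_two ht)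
  have j2 := fun i => MemLp.integrable_inner hv.memLp ((hvi i).memLp_pd i)
  have j3 := MemLp.integrable_inner (h.sobolev_gradPv.memLp_two ht) hv.memLp
  have hΔ : ∀ i, ∫ x, inner ℝ (v t x) (pd i (pd i (v t)) x) = - ∫ x, ‖pd i (v t) x‖ ^ 2 :=
    fun i => by
      rw [hv.integral_inner_pd (hvi i) i]; simp only [real_inner_self_eq_norm_sq]
  have e : ∀ x, inner ℝ (v t x) (momentumRHS v Pv f t x) = inner ℝ (v t x) (f t x) +
      (inner ℝ (v t x) (pd 0 (pd 0 (v t)) x) + inner ℝ (v t x) (pd 1 (pd 1 (v t)) x)) -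
      inner ℝ (gradient (Pv t) x) (v t x) := by
    intro x
    rw [momentumRHS, inner_add_right, inner_add_right, inner_add_right, inner_neg_right,
      real_inner_comm (gradient (Pv t) x)]
    ring
  simp only [e]
  have j4 : Integrable (fun x => inner ℝ (v t x) (pd 0 (pd 0 (v t)) x) +
      inner ℝ (v t x) (pd 1 (pd 1 (v t)) x)) := (j2 0).add (j2 1)
  rw [integral_sub (j1.fun_add j4) j3, integral_add j1 j4,
    integral_add (j2 0) (j2 1), hΔ, hΔ, hp, Fin.sum_univ_two]
  ring

lemma norm_fderiv_apply_sq_le {g : Plane → Plane} (x y : Plane) :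
    ‖fderiv ℝ g x y‖ ^ 2 ≤ ∑ i, ‖y‖ ^ 2 * ‖pd i g x‖ ^ 2 := by
  have h1 : ‖fderiv ℝ g x y‖ ≤ |y 0| * ‖pd 0 g x‖ + |y 1| * ‖pd 1 g x‖ := by
    rw [fderiv_apply_eq_sum, Fin.sum_univ_two]
    refine (norm_add_le _ _).trans_eq ?_
    simp only [norm_smul, Real.norm_eq_abs]
  have h2 : ‖y‖ ^ 2 = |y 0| ^ 2 + |y 1| ^ 2 := by
    rw [EuclideanSpace.norm_sq_eq, Fin.sum_univ_two]; simp
  rw [Fin.sum_univ_two, h2]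
  refine (pow_le_pow_left₀ (norm_nonneg _) h1 2).trans ?_
  nlinarith [sq_nonneg (|y 0| * ‖pd 1 g x‖ - |y 1| * ‖pd 0 g x‖)]

/-- `‖w·∇g‖²` is controlled by `ε ‖∇²g‖² + C_ε ‖w‖² ‖∇w‖² ‖∇g‖²`. -/
lemma integral_convection_sq_le {w g : Plane → Plane} (hw : IsH1 w) (hg : ContDiff ℝ ∞ g)
    (hgi : ∀ i, IsH1 (pd i g)) {ε : ℝ} (hε : 0 < ε) :
    Integrable (fun x => ‖fderiv ℝ g x (w x)‖ ^ 2) ∧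
    ∫ x, ‖fderiv ℝ g x (w x)‖ ^ 2 ≤ ε * (∑ i, ∑ j, ∫ x, ‖pd i (pd j g) x‖ ^ 2) +
      ladyConst ^ 2 / (4 * ε) * ((∫ x, ‖w x‖ ^ 2) * (∑ i, ∫ x, ‖pd i w x‖ ^ 2) *
        ∑ i, ∫ x, ‖pd i g x‖ ^ 2) := by
  have hS := fun i => hw.integral_sq_mul_sq_le (hgi i)
  have hI : Integrable (fun x => ∑ i, ‖w x‖ ^ 2 * ‖pd i g x‖ ^ 2) :=
    integrable_finsetSum _ fun i _ => (hS i).1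
  have hc : Continuous (fun x => fderiv ℝ g x (w x)) :=
    (hg.continuous_fderiv (by simp)).clm_apply hw.contDiff.continuous
  refine ⟨hI.mono' (hc.norm.pow 2).aestronglyMeasurable (Eventually.of_forall fun x => ?_), ?_⟩
  · rw [Real.norm_of_nonneg (by positivity)]; exact norm_fderiv_apply_sq_le x (w x)
  refine (integral_mono_of_nonneg (Eventually.of_forall fun x => by positivity) hI
    (Eventually.of_forall fun x => norm_fderiv_apply_sq_le x (w x))).trans ?_
  rw [integral_finsetSum _ fun i _ => (hS i).1, Finset.sum_comm, Finset.mul_sum, Finset.mul_sum,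
    Finset.mul_sum, ← Finset.sum_add_distrib]
  refine Finset.sum_le_sum fun i _ => ?_
  have hU : 0 ≤ (∫ x, ‖w x‖ ^ 2) * ∑ i, ∫ x, ‖pd i w x‖ ^ 2 :=
    mul_nonneg (integral_nonneg fun x => by positivity)
      (Finset.sum_nonneg fun i _ => integral_nonneg fun x => by positivity)
  have hA : 0 ≤ ∫ x, ‖pd i g x‖ ^ 2 := integral_nonneg fun x => by positivity
  have hH : 0 ≤ ∑ j, ∫ x, ‖pd j (pd i g) x‖ ^ 2 :=
    Finset.sum_nonneg fun i _ => integral_nonneg fun x => by positivity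
  have hSi := (hS i).2
  generalize (∫ x, ‖w x‖ ^ 2) * ∑ i, ∫ x, ‖pd i w x‖ ^ 2 = U at *
  generalize (∫ x, ‖pd i g x‖ ^ 2) = A at *
  generalize (∑ j, ∫ x, ‖pd j (pd i g) x‖ ^ 2) = H at *
  refine abs_le_of_sq_le_sq' ?_ (by have := ladyConst_pos; positivity) |>.2
  refine hSi.trans ?_
  have e1 : ladyConst ^ 2 * U * (A * H) = 4 * (ε * H) * (ladyConst ^ 2 / (4 * ε) * (U * A)) := by
    field_simp
  rw [e1]
  nlinarith [sq_nonneg (ε * H - ladyConst ^ 2 / (4 * ε) * (U * A))]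

end Momentum

section Dissipation

variable {ρ : ℝ → Plane → ℝ} {u : ℝ → Plane → Plane} {P : ℝ → Plane → ℝ}
  {v : ℝ → Plane → Plane} {Pv : ℝ → Plane → ℝ} {f : ℝ → Plane → Plane} {t t₀ t₁ : ℝ}

lemma IsSolLINS2D.sq_L2norm_sqrt_smul (h : IsSolLINS2D ρ u P v Pv f) (ht : 0 ≤ t)
    {g : Plane → Plane} (hg : MemLp g 2 volume) :
    L2norm (fun x => √(ρ t x) • g x) ^ 2 = ∫ x, ρ t x * ‖g x‖ ^ 2 := by
  have e : ∀ x, ‖√(ρ t x) • g x‖ ^ 2 = ρ t x * ‖g x‖ ^ 2 := fun x => by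
    rw [norm_smul, mul_pow, Real.norm_of_nonneg (Real.sqrt_nonneg _),
      Real.sq_sqrt (h.rho_nonneg ht x)]
  have hm : MemLp (fun x => √(ρ t x) • g x) 2 volume := by
    have hms : AEStronglyMeasurable (fun x => √(ρ t x) • g x) volume :=
      ((h.base.smooth_rho.contDiff ht).continuous.sqrt.aestronglyMeasurable).smul hg.1
    rw [memLp_two_iff_integrable_sq_norm hms]
    simp only [e]
    exact h.integrable_rho_sq ht hg
  rw [sq_L2norm hm]
  simp only [e]

lemma IsSolLINS2D.dissipation_eq (h : IsSolLINS2D ρ u P v Pv f) (ht : 0 ≤ t) :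
    dissipation ρ v Pv t = (∫ x, ρ t x * ‖timeDeriv v t x‖ ^ 2) +
      (∑ i, ∑ j, ∫ x, ‖pd i (pd j (v t)) x‖ ^ 2) + ∫ x, ‖gradient (Pv t) x‖ ^ 2 := by
  rw [dissipation, h.sq_L2norm_sqrt_smul ht (h.sobolev_v.timeDeriv.memLp_two ht),
    sq_L2norm_grad_grad (h.sobolev_v.contDiff ht) (fun i => (h.sobolev_v.pd i).isH1 ht),
    sq_L2norm (h.sobolev_gradPv.memLp_two ht)]

lemma dissipation_nonneg (ρ : ℝ → Plane → ℝ) (v : ℝ → Plane → Plane) (Pv : ℝ → Plane → ℝ) (t : ℝ) :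
    0 ≤ dissipation ρ v Pv t := by
  unfold dissipation; positivity

lemma IsSolLINS2D.intervalIntegrable_dissipation (h : IsSolLINS2D ρ u P v Pv f) (h0 : 0 ≤ t₀)
    (h1 : t₀ ≤ t₁) : IntervalIntegrable (dissipation ρ v Pv) volume t₀ t₁ := by
  have hsub : Icc t₀ t₁ ⊆ Ici 0 := fun t ht => h0.trans ht.1
  have hd := h.sobolev_v.timeDeriv.l2Field
  have i1 : IntervalIntegrable (fun t => ∫ x, ρ t x * ‖timeDeriv v t x‖ ^ 2) volume t₀ t₁ := by
    refine intervalIntegrable_slab h1 (integrable_slab_of_bound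
      (Φ := fun t x => ρ t x * ‖timeDeriv v t x‖ ^ 2) (B := fun t x => 2 * ‖timeDeriv v t x‖ ^ 2)
      (m := fun t => 2 * ∫ x, ‖timeDeriv v t x‖ ^ 2) ?_ (fun t ht => ?_) (fun t ht x => ?_) ?_
      (fun t ht => ?_))
    · exact ((ContDiffOn.continuousOn h.base.smooth_rho).mul (hd.continuousOn.norm.pow 2)).mono
        (Icc_prod_subset_halfSpace h0)
    · exact (MemLp.integrable_norm_sq (hd.memLp (hsub ht))).const_mul 2
    · rw [Real.norm_of_nonneg (mul_nonneg (h.rho_nonneg (hsub ht) x) (by positivity))]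
      exact mul_le_mul_of_nonneg_right (h.rho_upper t (hsub ht) x) (by positivity)
    · exact (continuousOn_const.mul hd.continuousOn_integral_sq).mono hsub
    · exact (integral_const_mul _ _).le
  have i2 : IntervalIntegrable (fun t => (∑ i, ∑ j, ∫ x, ‖pd i (pd j (v t)) x‖ ^ 2) +
      ∫ x, ‖gradient (Pv t) x‖ ^ 2) volume t₀ t₁ := by
    refine ContinuousOn.intervalIntegrable_of_Icc h1 (ContinuousOn.mono ?_ hsub)
    exact (continuousOn_finsetSum _ fun i _ => continuousOn_finsetSum _ fun j _ =>
      ((h.sobolev_v.pd j).pd i).l2Field.continuousOn_integral_sq).add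
        h.sobolev_gradPv.l2Field.continuousOn_integral_sq
  refine (i1.add i2).congr_ae ?_
  rw [uIoc_of_le h1]
  filter_upwards [ae_restrict_mem measurableSet_Ioc] with t ht
  rw [h.dissipation_eq (hsub (Ioc_subset_Icc_self ht)), add_assoc]

lemma test_timeDeriv_le {r : ℝ} {d b f l p : Plane} (hr : 1 / 2 ≤ r) (hr2 : r ≤ 2)
    (heq : r • d + r • b = f + l + -p) :
    -2 * inner ℝ l d ≤ - (r * ‖d‖ ^ 2) + 4 * ‖f‖ ^ 2 + 4 * ‖b‖ ^ 2 - 2 * inner ℝ p d := by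
  have h1 := congrArg (fun y => inner ℝ y d) heq
  simp only [inner_add_left, inner_smul_left, inner_neg_left, real_inner_self_eq_norm_sq,
    RCLike.conj_to_real] at h1
  have h2 : inner ℝ f d ≤ ‖f‖ * ‖d‖ := real_inner_le_norm f d
  have h3 : -(‖b‖ * ‖d‖) ≤ inner ℝ b d := neg_le_of_abs_le (abs_real_inner_le_norm b d)
  have h4 : 2 * (‖f‖ * ‖d‖) ≤ r / 2 * ‖d‖ ^ 2 + 4 * ‖f‖ ^ 2 := by
    nlinarith [sq_nonneg (‖d‖ - 4 * ‖f‖), mul_nonneg (sub_nonneg.2 hr) (sq_nonneg ‖d‖)]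
  have h5 : r * (-(‖b‖ * ‖d‖)) ≤ r * inner ℝ b d :=
    mul_le_mul_of_nonneg_left h3 (by linarith)
  have h6 : 2 * (r * (‖b‖ * ‖d‖)) ≤ r / 2 * ‖d‖ ^ 2 + 4 * ‖b‖ ^ 2 := by
    nlinarith [mul_nonneg (show (0 : ℝ) ≤ r by linarith) (sq_nonneg (‖d‖ - 2 * ‖b‖)),
      mul_nonneg (sub_nonneg.2 hr2) (sq_nonneg ‖b‖)]
  linarith

lemma stokes_sq_le {r : ℝ} {d b f l p : Plane} (hr : 1 / 2 ≤ r) (hr2 : r ≤ 2)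
    (heq : r • d + r • b = f + l + -p) :
    ‖l‖ ^ 2 + ‖p‖ ^ 2 ≤ 6 * (r * ‖d‖ ^ 2) + 12 * ‖b‖ ^ 2 + 3 * ‖f‖ ^ 2 + 2 * inner ℝ p l := by
  have h1 : l - p = r • d + r • b - f := by rw [heq]; abel
  have h2 : ‖l - p‖ ^ 2 = ‖l‖ ^ 2 - 2 * inner ℝ l p + ‖p‖ ^ 2 := norm_sub_sq_real l p
  have h3 : ‖l - p‖ ≤ r * ‖d‖ + r * ‖b‖ + ‖f‖ := by
    rw [h1]
    refine (norm_sub_le _ _).trans (add_le_add_left ((norm_add_le _ _).trans_eq ?_) _)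
    rw [norm_smul, norm_smul, Real.norm_of_nonneg (by linarith)]
  have h4 := pow_le_pow_left₀ (norm_nonneg _) h3 2
  have h5 : (r * ‖d‖ + r * ‖b‖ + ‖f‖) ^ 2 ≤ 3 * ((r * ‖d‖) ^ 2 + (r * ‖b‖) ^ 2 + ‖f‖ ^ 2) := by
    nlinarith [sq_nonneg (r * ‖d‖ - r * ‖b‖), sq_nonneg (r * ‖d‖ - ‖f‖), sq_nonneg (r * ‖b‖ - ‖f‖)]
  have h6 : (r * ‖d‖) ^ 2 ≤ 2 * (r * ‖d‖ ^ 2) := by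
    nlinarith [mul_nonneg (mul_nonneg (show (0 : ℝ) ≤ r by linarith) (sub_nonneg.2 hr2))
      (sq_nonneg ‖d‖)]
  have h7 : (r * ‖b‖) ^ 2 ≤ 4 * ‖b‖ ^ 2 := by
    rw [mul_pow]
    exact mul_le_mul_of_nonneg_right (by nlinarith) (sq_nonneg _)
  rw [real_inner_comm] at h2
  linarith

/-- The time derivative of `‖∇v‖²`, up to integration by parts. -/
def gradEnergyRate (v : ℝ → Plane → Plane) (t : ℝ) : ℝ :=
  ∑ i, 2 * ∫ x, inner ℝ (pd i (v t) x) (timeDeriv (fun t => pd i (v t)) t x)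

lemma gradEnergyRate_eq (hv : SmoothSobolev v) (ht : 0 ≤ t) :
    gradEnergyRate v t =
      ∫ x, -2 * inner ℝ (pd 0 (pd 0 (v t)) x + pd 1 (pd 1 (v t)) x) (timeDeriv v t x) := by
  have hd := hv.timeDeriv.isH1 ht
  have hvi : ∀ i, IsH1 (pd i (v t)) := fun i => (hv.pd i).isH1 ht
  have j := fun i => MemLp.integrable_inner ((hvi i).memLp_pd i) hd.memLp
  rw [gradEnergyRate, Fin.sum_univ_two, hv.smooth.timeDeriv_pd 0 ht, hv.smooth.timeDeriv_pd 1 ht,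
    (hvi 0).integral_inner_pd hd, (hvi 1).integral_inner_pd hd, integral_const_mul]
  simp only [inner_add_left]
  rw [integral_add (j 0) (j 1)]
  ring

lemma continuousOn_gradEnergyRate (hv : SmoothSobolev v) :
    ContinuousOn (gradEnergyRate v) (Ici 0) :=
  continuousOn_finsetSum _ fun i _ => continuousOn_const.mul
    ((hv.pd i).l2Field.continuousOn_integral_inner (hv.pd i).timeDeriv.l2Field)

lemma sq_L2norm_grad_sub (hv : SmoothSobolev v) (h0 : 0 ≤ t₀) (h1 : t₀ ≤ t₁) :
    L2norm (grad (v t₁)) ^ 2 - L2norm (grad (v t₀)) ^ 2 = ∫ t in t₀..t₁, gradEnergyRate v t := by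
  rw [sq_L2norm_grad (hv.isH1 (h0.trans h1)), sq_L2norm_grad (hv.isH1 h0),
    ← Finset.sum_sub_distrib]
  simp only [fun i => (hv.pd i).integral_sq_sub h0 h1]
  unfold gradEnergyRate
  rw [intervalIntegral.integral_finsetSum]
  intro i _
  exact ContinuousOn.intervalIntegrable_of_Icc h1 ((continuousOn_const.mul
    ((hv.pd i).l2Field.continuousOn_integral_inner (hv.pd i).timeDeriv.l2Field)).mono
      fun t ht => h0.trans ht.1)

/-- The differential inequality behind the gradient estimates. -/
lemma IsSolLINS2D.gradEnergyRate_add_dissipation_le (h : IsSolLINS2D ρ u P v Pv f) (ht : 0 ≤ t) :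
    gradEnergyRate v t + dissipation ρ v Pv t / 24 ≤ 5 * L2norm (f t) ^ 2 +
      150 * ladyConst ^ 2 * (L2norm (u t) ^ 2 * L2norm (grad (u t)) ^ 2) *
        L2norm (grad (v t)) ^ 2 := by
  have hv := h.sobolev_v
  have hvi : ∀ i, IsH1 (pd i (v t)) := fun i => (hv.pd i).isH1 ht
  have hvij : ∀ i j, IsH1 (pd i (pd j (v t))) := fun i j => ((hv.pd j).pd i).isH1 ht
  have hc := hv.contDiff ht
  have hd := hv.timeDeriv.isH1 ht
  have hu := h.base.sobolev_u.isH1 ht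
  have hf := h.sobolev_f.memLp_two ht
  have hp := h.sobolev_gradPv.memLp_two ht
  obtain ⟨hbi, hble⟩ := integral_convection_sq_le hu hc hvi (ε := 1 / 120) (by norm_num)
  have hYe := sum_integral_pd_pd_eq hvi hc hvij
  rw [h.dissipation_eq ht, sq_L2norm_grad (hv.isH1 ht), sq_L2norm_grad hu, sq_L2norm hf,
    sq_L2norm hu.memLp, gradEnergyRate_eq hv ht]
  have hdivd : ∀ i x, divergence (pd i (pd i (v t))) x = 0 := fun i =>
    divergence_pd (contDiff_pd hc i) (divergence_pd hc (h.incompressible t ht) i) i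
  have hpd := h.integral_gradient_eq_zero ht hd
    (divergence_timeDeriv hv.smooth h.incompressible ht)
  have hpl : ∫ x, inner ℝ (gradient (Pv t) x) (pd 0 (pd 0 (v t)) x + pd 1 (pd 1 (v t)) x) = 0 := by
    simp only [inner_add_right]
    rw [integral_add (MemLp.integrable_inner hp (hvij 0 0).memLp)
      (MemLp.integrable_inner hp (hvij 1 1).memLp),
      h.integral_gradient_eq_zero ht (hvij 0 0) (hdivd 0),
      h.integral_gradient_eq_zero ht (hvij 1 1) (hdivd 1), add_zero]
  have hl : MemLp (fun x => pd 0 (pd 0 (v t)) x + pd 1 (pd 1 (v t)) x) 2 volume :=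
    (hvij 0 0).memLp.add (hvij 1 1).memLp
  have k1 := h.integrable_rho_sq ht hd.memLp
  have k2 := MemLp.integrable_norm_sq hf
  have k3 := MemLp.integrable_inner hp hd.memLp
  have k4 := MemLp.integrable_inner hp hl
  have k5 := MemLp.integrable_norm_sq hl
  have k6 := MemLp.integrable_norm_sq hp
  have hRHS := fun x => h.momentumRHS_eq ht x
  unfold momentumRHS at hRHS
  have ineq1 : ∫ x, -2 * inner ℝ (pd 0 (pd 0 (v t)) x + pd 1 (pd 1 (v t)) x) (timeDeriv v t x) ≤
      - (∫ x, ρ t x * ‖timeDeriv v t x‖ ^ 2) + 4 * (∫ x, ‖f t x‖ ^ 2) +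
        4 * ∫ x, ‖fderiv ℝ (v t) x (u t x)‖ ^ 2 := by
    have hm := integral_mono ((MemLp.integrable_inner hl hd.memLp).const_mul (-2))
      (((k1.fun_neg.fun_add (k2.const_mul 4)).fun_add (hbi.const_mul 4)).sub (k3.const_mul 2))
      (fun x => test_timeDeriv_le (h.rho_lower t ht x) (h.rho_upper t ht x) (hRHS x))
    simp only [Pi.sub_apply] at hm
    rw [integral_sub ((k1.fun_neg.fun_add (k2.const_mul 4)).fun_add (hbi.const_mul 4))
      (k3.const_mul 2), integral_add (k1.fun_neg.fun_add (k2.const_mul 4)) (hbi.const_mul 4),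
      integral_add k1.fun_neg (k2.const_mul 4), integral_neg, integral_const_mul,
      integral_const_mul, integral_const_mul, integral_const_mul, hpd] at hm
    rw [integral_const_mul]
    linarith
  have ineq2 : (∑ i, ∑ j, ∫ x, ‖pd i (pd j (v t)) x‖ ^ 2) + ∫ x, ‖gradient (Pv t) x‖ ^ 2 ≤
      6 * (∫ x, ρ t x * ‖timeDeriv v t x‖ ^ 2) + 12 * (∫ x, ‖fderiv ℝ (v t) x (u t x)‖ ^ 2) +
        3 * ∫ x, ‖f t x‖ ^ 2 := by
    have hm := integral_mono (k5.fun_add k6)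
      ((((k1.const_mul 6).fun_add (hbi.const_mul 12)).fun_add (k2.const_mul 3)).fun_add
        (k4.const_mul 2))
      (fun x => stokes_sq_le (h.rho_lower t ht x) (h.rho_upper t ht x) (hRHS x))
    rw [integral_add k5 k6, integral_add (((k1.const_mul 6).fun_add (hbi.const_mul 12)).fun_add
      (k2.const_mul 3)) (k4.const_mul 2), integral_add ((k1.const_mul 6).fun_add
      (hbi.const_mul 12)) (k2.const_mul 3), integral_add (k1.const_mul 6) (hbi.const_mul 12),
      integral_const_mul, integral_const_mul, integral_const_mul, integral_const_mul, hpl] at hm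
    rw [hYe]
    simp only [Fin.sum_univ_two]
    linarith
  have hX : 0 ≤ ∫ x, ρ t x * ‖timeDeriv v t x‖ ^ 2 :=
    integral_nonneg fun x => mul_nonneg (h.rho_nonneg ht x) (by positivity)
  have hF : 0 ≤ ∫ x, ‖f t x‖ ^ 2 := integral_nonneg fun x => by positivity
  have hZ : 0 ≤ ∫ x, ‖gradient (Pv t) x‖ ^ 2 := integral_nonneg fun x => by positivity
  have e : ladyConst ^ 2 / (4 * (1 / 120)) = 30 * ladyConst ^ 2 := by ring
  rw [e] at hble
  linarith

end Dissipation

section Estimates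

variable {ρ : ℝ → Plane → ℝ} {u : ℝ → Plane → Plane} {P : ℝ → Plane → ℝ}
  {v : ℝ → Plane → Plane} {Pv : ℝ → Plane → ℝ} {f : ℝ → Plane → Plane} {t t₀ t₁ : ℝ}

/-- The velocity of the base flow solves the linearized system without force. -/
lemma IsSolLINS2D.self (h : IsSolLINS2D ρ u P v Pv f) :
    IsSolLINS2D ρ u P u P (fun _ _ => 0) where
  base := h.base
  rho_lower := h.rho_lower
  rho_upper := h.rho_upper
  sobolev_v := h.base.sobolev_u
  diff_Pv := h.base.diff_P
  sobolev_gradPv := h.base.sobolev_gradP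
  sobolev_f := smoothSobolev_zero
  momentum := h.base.momentum
  incompressible := h.base.incompressible

lemma continuousOn_sq_L2norm {p : ℝ → Plane → Plane} (hp : SmoothSobolev p) :
    ContinuousOn (fun t => L2norm (p t) ^ 2) (Ici 0) :=
  hp.l2Field.continuousOn_integral_sq.congr fun _ ht => sq_L2norm (hp.memLp_two ht)

lemma continuousOn_sq_L2norm_grad {p : ℝ → Plane → Plane} (hp : SmoothSobolev p) :
    ContinuousOn (fun t => L2norm (grad (p t)) ^ 2) (Ici 0) :=
  ContinuousOn.congr (f := fun t => ∑ i, ∫ x, ‖pd i (p t) x‖ ^ 2)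
    (continuousOn_finsetSum _ fun i _ => (hp.pd i).l2Field.continuousOn_integral_sq)
    fun _ ht => sq_L2norm_grad (hp.isH1 ht)

/-- The kinetic energy `∫ ρ |v|²`. -/
def kineticEnergy (ρ : ℝ → Plane → ℝ) (v : ℝ → Plane → Plane) (t : ℝ) : ℝ :=
  ∫ x, ρ t x * ‖v t x‖ ^ 2

lemma IsSolLINS2D.kineticEnergy_le (h : IsSolLINS2D ρ u P v Pv f) (ht : 0 ≤ t) :
    kineticEnergy ρ v t ≤ 2 * L2norm (v t) ^ 2 := by
  have hv := h.sobolev_v.memLp_two ht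
  rw [sq_L2norm hv, ← integral_const_mul]
  exact integral_mono (h.integrable_rho_sq ht hv) ((MemLp.integrable_norm_sq hv).const_mul 2)
    fun x => mul_le_mul_of_nonneg_right (h.rho_upper t ht x) (by positivity)

lemma IsSolLINS2D.le_kineticEnergy (h : IsSolLINS2D ρ u P v Pv f) (ht : 0 ≤ t) :
    L2norm (v t) ^ 2 ≤ 2 * kineticEnergy ρ v t := by
  have hv := h.sobolev_v.memLp_two ht
  rw [sq_L2norm hv, kineticEnergy, ← integral_const_mul]
  refine integral_mono (MemLp.integrable_norm_sq hv) ((h.integrable_rho_sq ht hv).const_mul 2)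
    fun x => ?_
  have := mul_le_mul_of_nonneg_right (h.rho_lower t ht x) (sq_nonneg ‖v t x‖)
  simp only
  linarith

lemma IsSolLINS2D.kineticEnergy_nonneg (h : IsSolLINS2D ρ u P v Pv f) (ht : 0 ≤ t) :
    0 ≤ kineticEnergy ρ v t :=
  integral_nonneg fun x => mul_nonneg (h.rho_nonneg ht x) (by positivity)

/-- The time derivative of the kinetic energy. -/
def kineticRate (v : ℝ → Plane → Plane) (f : ℝ → Plane → Plane) (t : ℝ) : ℝ :=
  2 * (∫ x, inner ℝ (v t x) (f t x)) - 2 * L2norm (grad (v t)) ^ 2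

lemma IsSolLINS2D.continuousOn_kineticRate (h : IsSolLINS2D ρ u P v Pv f) :
    ContinuousOn (kineticRate v f) (Ici 0) :=
  (continuousOn_const.mul (h.sobolev_v.l2Field.continuousOn_integral_inner
    h.sobolev_f.l2Field)).sub (continuousOn_const.mul (continuousOn_sq_L2norm_grad h.sobolev_v))

lemma IsSolLINS2D.kineticEnergy_sub (h : IsSolLINS2D ρ u P v Pv f) (h0 : 0 ≤ t₀) (h1 : t₀ ≤ t₁) :
    kineticEnergy ρ v t₁ - kineticEnergy ρ v t₀ = ∫ t in t₀..t₁, kineticRate v f t := by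
  refine (h.energy_eq h0 h1).trans (intervalIntegral.integral_congr fun t ht => ?_)
  rw [uIcc_of_le h1] at ht
  have ht0 : 0 ≤ t := h0.trans ht.1
  simp only [h.integral_inner_momentumRHS ht0, kineticRate, sq_L2norm_grad (h.sobolev_v.isH1 ht0)]
  ring

/-- The energy balance of the base flow. -/
lemma IsSolLINS2D.base_energy (h : IsSolLINS2D ρ u P v Pv f) (h0 : 0 ≤ t₀) (h1 : t₀ ≤ t₁) :
    kineticEnergy ρ u t₁ + 2 * ∫ t in t₀..t₁, L2norm (grad (u t)) ^ 2 = kineticEnergy ρ u t₀ := by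
  have := h.self.kineticEnergy_sub h0 h1
  simp only [kineticRate, inner_zero_right, integral_zero, mul_zero, zero_sub,
    intervalIntegral.integral_neg, intervalIntegral.integral_const_mul] at this
  linarith

lemma IsSolLINS2D.integral_growth_le (h : IsSolLINS2D ρ u P v Pv f) (h0 : 0 ≤ t₀) (h1 : t₀ ≤ t₁) :
    ∫ t in t₀..t₁, L2norm (u t) ^ 2 * L2norm (grad (u t)) ^ 2 ≤ 4 * L2norm (u t₀) ^ 4 := by
  have hsub : Icc t₀ t₁ ⊆ Ici 0 := fun t ht => h0.trans ht.1
  have hU := (continuousOn_sq_L2norm h.base.sobolev_u).mono hsub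
  have hV := (continuousOn_sq_L2norm_grad h.base.sobolev_u).mono hsub
  have hE0 := h.self.kineticEnergy_le h0
  have hUle : ∀ t ∈ Icc t₀ t₁, L2norm (u t) ^ 2 ≤ 4 * L2norm (u t₀) ^ 2 := by
    intro t ht
    have e1 := h.base_energy h0 ht.1
    have e2 := h.self.le_kineticEnergy (hsub ht)
    have e3 : 0 ≤ ∫ t in t₀..t, L2norm (grad (u t)) ^ 2 :=
      intervalIntegral.integral_nonneg ht.1 fun s _ => by positivity
    linarith
  have hVle : ∫ t in t₀..t₁, L2norm (grad (u t)) ^ 2 ≤ L2norm (u t₀) ^ 2 := by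
    have e1 := h.base_energy h0 h1
    have e2 := h.self.kineticEnergy_nonneg (h0.trans h1)
    linarith
  calc _ ≤ ∫ t in t₀..t₁, 4 * L2norm (u t₀) ^ 2 * L2norm (grad (u t)) ^ 2 :=
        intervalIntegral.integral_mono_on h1 ((hU.mul hV).intervalIntegrable_of_Icc h1)
          ((continuousOn_const.mul hV).intervalIntegrable_of_Icc h1)
          fun t ht => mul_le_mul_of_nonneg_right (hUle t ht) (by positivity)
    _ = 4 * L2norm (u t₀) ^ 2 * ∫ t in t₀..t₁, L2norm (grad (u t)) ^ 2 :=
        intervalIntegral.integral_const_mul _ _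
    _ ≤ 4 * L2norm (u t₀) ^ 2 * L2norm (u t₀) ^ 2 :=
        mul_le_mul_of_nonneg_left hVle (by positivity)
    _ = _ := by ring

/-- The weighted gradient estimate. -/
lemma IsSolLINS2D.weighted_estimate (h : IsSolLINS2D ρ u P v Pv f) (h0 : 0 ≤ t₀) (h1 : t₀ ≤ t₁)
    {θ θ' : ℝ → ℝ} (hθc : ContinuousOn θ (Icc t₀ t₁)) (hθ'c : ContinuousOn θ' (Icc t₀ t₁))
    (hθ : ∀ t ∈ Ioo t₀ t₁, HasDerivAt θ (θ' t) t) (hθ0 : ∀ t ∈ Icc t₀ t₁, 0 ≤ θ t)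
    (hθ'0 : ∀ t ∈ Icc t₀ t₁, 0 ≤ θ' t) :
    θ t₁ * L2norm (grad (v t₁)) ^ 2 + (∫ t in t₀..t₁, θ t * dissipation ρ v Pv t) / 24 ≤
      (θ t₀ * L2norm (grad (v t₀)) ^ 2 + (∫ t in t₀..t₁, θ' t * L2norm (grad (v t)) ^ 2) +
        5 * ∫ t in t₀..t₁, θ t * L2norm (f t) ^ 2) *
        Real.exp (600 * ladyConst ^ 2 * L2norm (u t₀) ^ 4) := by
  have hsub : Icc t₀ t₁ ⊆ Ici 0 := fun t ht => h0.trans ht.1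
  have hU := (continuousOn_sq_L2norm h.base.sobolev_u).mono hsub
  have hV := (continuousOn_sq_L2norm_grad h.base.sobolev_u).mono hsub
  have hF := (continuousOn_sq_L2norm h.sobolev_f).mono hsub
  have hg := weighted_gronwall (A := fun t => L2norm (grad (v t)) ^ 2) (a := gradEnergyRate v)
    (D := fun t => dissipation ρ v Pv t / 24) (r := fun t => 5 * L2norm (f t) ^ 2)
    (m := fun t => 150 * ladyConst ^ 2 * (L2norm (u t) ^ 2 * L2norm (grad (u t)) ^ 2)) h1
    (fun t ht => sq_L2norm_grad_sub h.sobolev_v h0 ht.1)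
    ((continuousOn_gradEnergyRate h.sobolev_v).mono hsub) (continuousOn_const.mul hF)
    (continuousOn_const.mul (hU.mul hV)) ((h.intervalIntegrable_dissipation h0 h1).div_const 24)
    hθc hθ'c hθ (fun t _ => by positivity) (fun t _ => by positivity) (fun t _ => by positivity)
    (fun t _ => div_nonneg (dissipation_nonneg ρ v Pv t) (by norm_num)) hθ0 hθ'0
    (fun t ht => h.gradEnergyRate_add_dissipation_le (hsub ht))
  simp only [mul_div_assoc', intervalIntegral.integral_div, mul_left_comm _ (5 : ℝ),
    intervalIntegral.integral_const_mul] at hg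
  refine hg.trans (mul_le_mul_of_nonneg_left (Real.exp_le_exp.2 ?_) ?_)
  · calc _ ≤ 150 * ladyConst ^ 2 * (4 * L2norm (u t₀) ^ 4) :=
        mul_le_mul_of_nonneg_left (h.integral_growth_le h0 h1) (by positivity)
      _ = _ := by ring
  · have a1 : 0 ≤ θ t₀ * L2norm (grad (v t₀)) ^ 2 :=
      mul_nonneg (hθ0 t₀ (left_mem_Icc.2 h1)) (by positivity)
    have a2 : 0 ≤ ∫ t in t₀..t₁, θ' t * L2norm (grad (v t)) ^ 2 :=
      intervalIntegral.integral_nonneg h1 fun t ht => mul_nonneg (hθ'0 t ht) (by positivity)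
    have a3 : 0 ≤ ∫ t in t₀..t₁, θ t * L2norm (f t) ^ 2 :=
      intervalIntegral.integral_nonneg h1 fun t ht => mul_nonneg (hθ0 t ht) (by positivity)
    positivity

lemma IsSolLINS2D.kineticRate_add_le (h : IsSolLINS2D ρ u P v Pv f) (ht : 0 ≤ t) {c : ℝ}
    (hc : 0 < c) :
    kineticRate v f t + 2 * L2norm (grad (v t)) ^ 2 ≤
      2 * c * L2norm (f t) ^ 2 + 1 / c * kineticEnergy ρ v t := by
  have hv := h.sobolev_v.memLp_two ht
  have hf := h.sobolev_f.memLp_two ht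
  have hi := h.integrable_rho_sq ht hv
  rw [kineticRate, sub_add_cancel, sq_L2norm hf, kineticEnergy, ← integral_const_mul,
    ← integral_const_mul, ← integral_const_mul, ← integral_add
      ((MemLp.integrable_norm_sq hf).const_mul _) (hi.const_mul _)]
  refine integral_mono ((MemLp.integrable_inner hv hf).const_mul 2)
    (((MemLp.integrable_norm_sq hf).const_mul _).add (hi.const_mul _)) fun x => ?_
  have e1 := real_inner_le_norm (v t x) (f t x)
  have e2 := mul_le_mul_of_nonneg_right (h.rho_lower t ht x) (sq_nonneg ‖v t x‖)
  have e3 : 1 / c * (1 / 2 * ‖v t x‖ ^ 2) ≤ 1 / c * (ρ t x * ‖v t x‖ ^ 2) :=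
    mul_le_mul_of_nonneg_left e2 (by positivity)
  have e4 : 2 * c * ‖f t x‖ ^ 2 + 1 / c * (1 / 2 * ‖v t x‖ ^ 2) - 2 * (‖v t x‖ * ‖f t x‖) =
      1 / (2 * c) * (‖v t x‖ - 2 * c * ‖f t x‖) ^ 2 := by
    field_simp; ring
  have e5 : 0 ≤ 1 / (2 * c) * (‖v t x‖ - 2 * c * ‖f t x‖) ^ 2 := by positivity
  simp only
  linarith

lemma IsSolLINS2D.integral_sq_grad_le (h : IsSolLINS2D ρ u P v Pv f) (ht : 0 < t) :
    ∫ τ in (t / 2)..t, L2norm (grad (v τ)) ^ 2 ≤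
      2 * L2norm (v (t / 2)) ^ 2 + 2 * t * ∫ τ in (t / 2)..t, L2norm (f τ) ^ 2 := by
  have h0 : 0 ≤ t / 2 := by positivity
  have h1 : t / 2 ≤ t := by linarith
  have hsub : Icc (t / 2) t ⊆ Ici 0 := fun τ hτ => h0.trans hτ.1
  have hF := (continuousOn_sq_L2norm h.sobolev_f).mono hsub
  have hG := (continuousOn_sq_L2norm_grad h.sobolev_v).mono hsub
  have hg := weighted_gronwall (A := kineticEnergy ρ v) (a := kineticRate v f)
    (D := fun τ => 2 * L2norm (grad (v τ)) ^ 2) (r := fun τ => 2 * t * L2norm (f τ) ^ 2)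
    (m := fun _ => 1 / t) (θ := fun _ => 1) (θ' := fun _ => 0) h1
    (fun τ hτ => h.kineticEnergy_sub h0 hτ.1) (h.continuousOn_kineticRate.mono hsub)
    (continuousOn_const.mul hF) continuousOn_const
    ((continuousOn_const.mul hG).intervalIntegrable_of_Icc h1) continuousOn_const
    continuousOn_const (fun τ _ => hasDerivAt_const τ 1)
    (fun τ hτ => h.kineticEnergy_nonneg (hsub hτ)) (fun τ _ => by positivity)
    (fun τ _ => by positivity) (fun τ _ => by positivity) (fun τ _ => zero_le_one)
    (fun τ _ => le_rfl) (fun τ hτ => h.kineticRate_add_le (hsub hτ) ht)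
  simp only [one_mul, zero_mul, intervalIntegral.integral_zero, add_zero,
    intervalIntegral.integral_const_mul, intervalIntegral.integral_const, smul_eq_mul] at hg
  have he : (t - t / 2) * (1 / t) = 1 / 2 := by field_simp; ring
  rw [he] at hg
  have hexp : Real.exp (1 / 2) ≤ 2 := by
    have e1 : Real.exp (1 / 2) ^ 2 = Real.exp 1 := by rw [← Real.exp_nat_mul]; norm_num
    have e2 := Real.exp_one_lt_d9
    nlinarith [Real.exp_pos (1 / 2 : ℝ)]
  have hE := h.kineticEnergy_nonneg ht.le
  have hE0 := h.kineticEnergy_nonneg h0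
  have hE1 := h.kineticEnergy_le h0
  have hFi : 0 ≤ ∫ τ in (t / 2)..t, L2norm (f τ) ^ 2 :=
    intervalIntegral.integral_nonneg h1 fun τ _ => by positivity
  have hS : 0 ≤ kineticEnergy ρ v (t / 2) + 2 * t * ∫ τ in (t / 2)..t, L2norm (f τ) ^ 2 := by
    positivity
  have := mul_le_mul_of_nonneg_left hexp hS
  linarith

lemma IsSolLINS2D.smoothing_estimate (h : IsSolLINS2D ρ u P v Pv f) (ht : 0 < t) :
    t * L2norm (grad (v t)) ^ 2 ≤
      9 * (L2norm (v (t / 2)) ^ 2 + t * ∫ τ in (t / 2)..t, L2norm (f τ) ^ 2) *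
        Real.exp (600 * ladyConst ^ 2 * L2norm (u (t / 2)) ^ 4) := by
  have h0 : 0 ≤ t / 2 := by positivity
  have h1 : t / 2 ≤ t := by linarith
  have hsub : Icc (t / 2) t ⊆ Ici 0 := fun τ hτ => h0.trans hτ.1
  have hF := (continuousOn_sq_L2norm h.sobolev_f).mono hsub
  have hw := h.weighted_estimate h0 h1 (θ := fun τ => τ - t / 2) (θ' := fun _ => 1)
    (continuous_id.sub continuous_const).continuousOn continuousOn_const
    (fun τ _ => (hasDerivAt_id τ).sub_const _) (fun τ hτ => sub_nonneg.2 hτ.1)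
    (fun τ _ => zero_le_one)
  have hD : 0 ≤ ∫ τ in (t / 2)..t, (τ - t / 2) * dissipation ρ v Pv τ :=
    intervalIntegral.integral_nonneg h1 fun τ hτ =>
      mul_nonneg (sub_nonneg.2 hτ.1) (dissipation_nonneg ρ v Pv τ)
  have hFw : ∫ τ in (t / 2)..t, (τ - t / 2) * L2norm (f τ) ^ 2 ≤
      t / 2 * ∫ τ in (t / 2)..t, L2norm (f τ) ^ 2 := by
    rw [← intervalIntegral.integral_const_mul]
    refine intervalIntegral.integral_mono_on h1
      (((continuous_id.sub continuous_const).continuousOn.mul hF).intervalIntegrable_of_Icc h1)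
      ((continuousOn_const.mul hF).intervalIntegrable_of_Icc h1) fun τ hτ => ?_
    exact mul_le_mul_of_nonneg_right (by linarith [hτ.2]) (by positivity)
  have hG := h.integral_sq_grad_le ht
  simp only [sub_self, zero_mul, zero_add, one_mul] at hw
  have hpos := Real.exp_pos (600 * ladyConst ^ 2 * L2norm (u (t / 2)) ^ 4)
  have hFi : 0 ≤ ∫ τ in (t / 2)..t, L2norm (f τ) ^ 2 :=
    intervalIntegral.integral_nonneg h1 fun τ _ => by positivity
  have hk : (∫ τ in (t / 2)..t, L2norm (grad (v τ)) ^ 2) +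
      5 * (∫ τ in (t / 2)..t, (τ - t / 2) * L2norm (f τ) ^ 2) ≤
      9 / 2 * (L2norm (v (t / 2)) ^ 2 + t * ∫ τ in (t / 2)..t, L2norm (f τ) ^ 2) := by
    nlinarith [sq_nonneg (L2norm (v (t / 2)))]
  have := mul_le_mul_of_nonneg_right hk hpos.le
  linarith

lemma bracket_pos {T t : ℝ} (hT : 0 < T) (ht : 0 ≤ t) : 0 < bracket T t :=
  add_pos_of_pos_of_nonneg (Real.exp_pos 1) (by positivity)

lemma hasDerivAt_bracket_rpow {T t : ℝ} (hT : 0 < T) (ht : 0 ≤ t) (s : ℝ) :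
    HasDerivAt (fun t => bracket T t ^ s) (s * (bracket T t ^ (s - 1) * (1 / T))) t := by
  have h1 : HasDerivAt (bracket T) (1 / T) t := ((hasDerivAt_id t).div_const T).const_add _
  convert h1.rpow_const (p := s) (Or.inl (bracket_pos hT ht).ne') using 1
  ring

lemma mul_mul_exp_le {c k C S x y : ℝ} (hc : c ≤ C) (hk : k ≤ C) (hC : 0 ≤ C) (hS : 0 ≤ S)
    (hx : 0 ≤ x) (hy : y ≤ c * S * Real.exp (k * x)) : y ≤ C * S * Real.exp (C * x) :=
  hy.trans (mul_le_mul (mul_le_mul_of_nonneg_right hc hS)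
    (Real.exp_le_exp.2 (mul_le_mul_of_nonneg_right hk hx)) (Real.exp_pos _).le (mul_nonneg hC hS))

lemma IsSolLINS2D.gradient_estimate (h : IsSolLINS2D ρ u P v Pv f) (h0 : 0 ≤ t₀) (h1 : t₀ ≤ t₁) :
    L2norm (grad (v t₁)) ^ 2 + ∫ t in t₀..t₁, dissipation ρ v Pv t ≤
      120 * (L2norm (grad (v t₀)) ^ 2 + ∫ t in t₀..t₁, L2norm (f t) ^ 2) *
        Real.exp (600 * ladyConst ^ 2 * L2norm (u t₀) ^ 4) := by
  have hw := h.weighted_estimate h0 h1 (θ := fun _ => 1) (θ' := fun _ => 0) continuousOn_const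
    continuousOn_const (fun τ _ => hasDerivAt_const τ 1) (fun τ _ => zero_le_one)
    (fun τ _ => le_rfl)
  simp only [one_mul, zero_mul, intervalIntegral.integral_zero, add_zero] at hw
  have hpos := Real.exp_pos (600 * ladyConst ^ 2 * L2norm (u t₀) ^ 4)
  have hk : L2norm (grad (v t₀)) ^ 2 + 5 * (∫ t in t₀..t₁, L2norm (f t) ^ 2) ≤
      5 * (L2norm (grad (v t₀)) ^ 2 + ∫ t in t₀..t₁, L2norm (f t) ^ 2) := by
    nlinarith [sq_nonneg (L2norm (grad (v t₀)))]
  have := mul_le_mul_of_nonneg_right hk hpos.le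
  nlinarith [sq_nonneg (L2norm (grad (v t₁)))]

lemma IsSolLINS2D.bracket_estimate (h : IsSolLINS2D ρ u P v Pv f) {s T : ℝ} (hs : 0 < s)
    (hT : 0 < T) (h0 : 0 ≤ t₀) (h1 : t₀ ≤ t₁) :
    bracket T t₁ ^ s * L2norm (grad (v t₁)) ^ 2
        + ∫ t in t₀..t₁, bracket T t ^ s * dissipation ρ v Pv t ≤
      (24 * s + 120) * (bracket T t₀ ^ s * L2norm (grad (v t₀)) ^ 2
        + (∫ t in t₀..t₁, bracket T t ^ (s - 1) * L2norm (grad (v t)) ^ 2 * (1 / T))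
        + ∫ t in t₀..t₁, bracket T t ^ s * L2norm (f t) ^ 2) *
        Real.exp (600 * ladyConst ^ 2 * L2norm (u t₀) ^ 4) := by
  have hb : ∀ t ∈ Icc t₀ t₁, 0 < bracket T t := fun t ht => bracket_pos hT (h0.trans ht.1)
  have hbc : ∀ r : ℝ, ContinuousOn (fun t => bracket T t ^ r) (Icc t₀ t₁) := fun r t ht =>
    (hasDerivAt_bracket_rpow hT (h0.trans ht.1) r).continuousAt.continuousWithinAt
  have hw := h.weighted_estimate h0 h1 (θ := fun t => bracket T t ^ s)
    (θ' := fun t => s * (bracket T t ^ (s - 1) * (1 / T))) (hbc s)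
    (continuousOn_const.mul ((hbc (s - 1)).mul continuousOn_const))
    (fun t ht => hasDerivAt_bracket_rpow hT (h0.trans ht.1.le) s)
    (fun t ht => (Real.rpow_pos_of_pos (hb t ht) s).le)
    (fun t ht => by have := Real.rpow_pos_of_pos (hb t ht) (s - 1); positivity)
  have e : ∀ t, s * (bracket T t ^ (s - 1) * (1 / T)) * L2norm (grad (v t)) ^ 2 =
      s * (bracket T t ^ (s - 1) * L2norm (grad (v t)) ^ 2 * (1 / T)) := fun t => by ring
  simp only [e, intervalIntegral.integral_const_mul] at hw
  have hpos := Real.exp_pos (600 * ladyConst ^ 2 * L2norm (u t₀) ^ 4)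
  have p0 : 0 ≤ bracket T t₀ ^ s * L2norm (grad (v t₀)) ^ 2 :=
    mul_nonneg (Real.rpow_pos_of_pos (hb t₀ (left_mem_Icc.2 h1)) s).le (by positivity)
  have p1 : 0 ≤ bracket T t₁ ^ s * L2norm (grad (v t₁)) ^ 2 :=
    mul_nonneg (Real.rpow_pos_of_pos (hb t₁ (right_mem_Icc.2 h1)) s).le (by positivity)
  have p2 : 0 ≤ ∫ t in t₀..t₁, bracket T t ^ (s - 1) * L2norm (grad (v t)) ^ 2 * (1 / T) :=
    intervalIntegral.integral_nonneg h1 fun t ht => by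
      have := Real.rpow_pos_of_pos (hb t ht) (s - 1); positivity
  have p3 : 0 ≤ ∫ t in t₀..t₁, bracket T t ^ s * L2norm (f t) ^ 2 :=
    intervalIntegral.integral_nonneg h1 fun t ht => by
      have := Real.rpow_pos_of_pos (hb t ht) s; positivity
  generalize bracket T t₀ ^ s * L2norm (grad (v t₀)) ^ 2 = A₀ at *
  generalize (∫ t in t₀..t₁, bracket T t ^ (s - 1) * L2norm (grad (v t)) ^ 2 * (1 / T)) = G at *
  generalize (∫ t in t₀..t₁, bracket T t ^ s * L2norm (f t) ^ 2) = F at *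
  have hk : A₀ + s * G + 5 * F ≤ (s + 5) * (A₀ + G + F) := by
    nlinarith [mul_nonneg hs.le p0, mul_nonneg hs.le p3]
  have := mul_le_mul_of_nonneg_right hk hpos.le
  linarith

end Estimates

end

theorem stmt_2 :
    (∃ C > (0 : ℝ),
      ∀ (ρ : ℝ → Plane → ℝ) (u : ℝ → Plane → Plane) (P : ℝ → Plane → ℝ)
        (v : ℝ → Plane → Plane) (Pv : ℝ → Plane → ℝ) (f : ℝ → Plane → Plane),
        IsSolLINS2D ρ u P v Pv f →
        (∀ t₀ t : ℝ, 0 ≤ t₀ → t₀ ≤ t →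
          L2norm (grad (v t)) ^ 2 + ∫ t' in t₀..t, dissipation ρ v Pv t'
            ≤ C * (L2norm (grad (v t₀)) ^ 2 + ∫ t' in t₀..t, L2norm (f t') ^ 2)
                * Real.exp (C * L2norm (u t₀) ^ 4)) ∧
        (∀ t : ℝ, 0 < t →
          t * L2norm (grad (v t)) ^ 2
            ≤ C * (L2norm (v (t / 2)) ^ 2 + t * ∫ t' in (t / 2)..t, L2norm (f t') ^ 2)
                * Real.exp (C * L2norm (u (t / 2)) ^ 4))) ∧
    (∀ s : ℝ, 0 < s → ∃ C > (0 : ℝ),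
      ∀ (ρ : ℝ → Plane → ℝ) (u : ℝ → Plane → Plane) (P : ℝ → Plane → ℝ)
        (v : ℝ → Plane → Plane) (Pv : ℝ → Plane → ℝ) (f : ℝ → Plane → Plane),
        IsSolLINS2D ρ u P v Pv f →
        ∀ T : ℝ, 0 < T → ∀ t₀ t : ℝ, 0 ≤ t₀ → t₀ ≤ t →
          bracket T t ^ s * L2norm (grad (v t)) ^ 2
              + ∫ t' in t₀..t, bracket T t' ^ s * dissipation ρ v Pv t'
            ≤ C * (bracket T t₀ ^ s * L2norm (grad (v t₀)) ^ 2
                  + (∫ t' in t₀..t, bracket T t' ^ (s - 1) * L2norm (grad (v t')) ^ 2 * (1 / T))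
                  + ∫ t' in t₀..t, bracket T t' ^ s * L2norm (f t') ^ 2)
                * Real.exp (C * L2norm (u t₀) ^ 4)) := by

  have hL : 0 ≤ 600 * ladyConst ^ 2 := by positivity
  refine ⟨⟨120 + 600 * ladyConst ^ 2, by positivity, ?_⟩, fun s hs =>
    ⟨24 * s + 120 + 600 * ladyConst ^ 2, by positivity, ?_⟩⟩
  · intro ρ u P v Pv f h
    refine ⟨fun t₀ t h0 h1 => ?_, fun t ht => ?_⟩
    · have hF : 0 ≤ ∫ t' in t₀..t, L2norm (f t') ^ 2 :=
        intervalIntegral.integral_nonneg h1 fun τ _ => by positivity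
      exact mul_mul_exp_le (by linarith) (by linarith) (by positivity) (by positivity)
        (by positivity) (h.gradient_estimate h0 h1)
    · have hF : 0 ≤ ∫ t' in (t / 2)..t, L2norm (f t') ^ 2 :=
        intervalIntegral.integral_nonneg (by linarith) fun τ _ => by positivity
      exact mul_mul_exp_le (by linarith) (by linarith) (by positivity) (by positivity)
        (by positivity) (h.smoothing_estimate ht)
  · intro ρ u P v Pv f h T hT t₀ t h0 h1
    have hb : ∀ r : ℝ, ∀ τ ∈ Icc t₀ t, 0 ≤ bracket T τ ^ r := fun r τ hτ =>
      (Real.rpow_pos_of_pos (bracket_pos hT (h0.trans hτ.1)) r).le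
    have hA : 0 ≤ bracket T t₀ ^ s * L2norm (grad (v t₀)) ^ 2 :=
      mul_nonneg (hb s t₀ (left_mem_Icc.2 h1)) (by positivity)
    have hG : 0 ≤ ∫ t' in t₀..t, bracket T t' ^ (s - 1) * L2norm (grad (v t')) ^ 2 * (1 / T) :=
      intervalIntegral.integral_nonneg h1 fun τ hτ =>
        mul_nonneg (mul_nonneg (hb _ τ hτ) (by positivity)) (by positivity)
    have hF : 0 ≤ ∫ t' in t₀..t, bracket T t' ^ s * L2norm (f t') ^ 2 :=
      intervalIntegral.integral_nonneg h1 fun τ hτ => mul_nonneg (hb _ τ hτ) (by positivity)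
    exact mul_mul_exp_le (by linarith) (by linarith) (by positivity) (by positivity)
      (by positivity) (h.bracket_estimate hs hT h0 h1)
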